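/- arXiv:2603.11490 — 11 statements merged into one kernel-verified Lean document; each statement's English description precedes it below -/
import Mathlib

section
/- Let k be a field of characteristic zero, let n ≥ 1, let w : Fin (n+1) → ℕ be a weight function with w i > 0 for all i, and let q be a positive natural number. Then the scheme Proj of MvPolynomial (Fin (n+1)) k graded by the weighted homogeneous submodules with respect to w is isomorphic, as a scheme, to the Proj of MvPolynomial (Fin (n+1)) k graded by the weighted homogeneous submodules with respect to the scaled weights (fun i => q * w i). -/
open MvPolynomial AlgebraicGeometry

attribute [local instance] MvPolynomial.weightedGradedAlgebra

open CategoryTheory Limits HomogeneousLocalization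

section Regrading

variable {σ τ : Type*} {A : Type*} [CommRing A]
  [SetLike σ A] [AddSubgroupClass σ A] [SetLike τ A] [AddSubgroupClass τ A]

/-- A grading `ℬ` dominates a grading `𝒜` of the same ring if every `ℬ`-homogeneous element `f` of
positive degree is `𝒜`-homogeneous of positive degree, and each element of `A_f` which has
degree zero for `𝒜` also has degree zero for `ℬ`. -/
structure AwayDominates (𝒜 : ℕ → σ) (ℬ : ℕ → τ) [GradedRing 𝒜] [GradedRing ℬ] : Prop where
  exists_mem : ∀ {f : A} {m : ℕ}, 0 < m → f ∈ ℬ m → ∃ d, 0 < d ∧ f ∈ 𝒜 d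
  exists_val_eq : ∀ {f : A} {m : ℕ}, 0 < m → f ∈ ℬ m →
    ∀ x : Away 𝒜 f, ∃ y : Away ℬ f, y.val = x.val

namespace AwayDominates

variable {𝒜 : ℕ → σ} {ℬ : ℕ → τ} [GradedRing 𝒜] [GradedRing ℬ]

/-- The inclusion of degree-zero subrings of `A_f`. -/
noncomputable def awayHom (h : AwayDominates 𝒜 ℬ) {f : A} {m : ℕ} (hm : 0 < m) (hf : f ∈ ℬ m) :
    Away 𝒜 f →+* Away ℬ f where
  toFun x := (h.exists_val_eq hm hf x).choose
  map_one' := val_injective _ <| by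
    rw [(h.exists_val_eq hm hf _).choose_spec, val_one, val_one]
  map_zero' := val_injective _ <| by
    rw [(h.exists_val_eq hm hf _).choose_spec, val_zero, val_zero]
  map_mul' x y := val_injective _ <|
    (h.exists_val_eq hm hf _).choose_spec.trans <| (val_mul x y).trans <|
      (congrArg₂ (· * ·) (h.exists_val_eq hm hf x).choose_spec.symm
        (h.exists_val_eq hm hf y).choose_spec.symm).trans (val_mul _ _).symm
  map_add' x y := val_injective _ <|
    (h.exists_val_eq hm hf _).choose_spec.trans <| (val_add x y).trans <|
      (congrArg₂ (· + ·) (h.exists_val_eq hm hf x).choose_spec.symm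
        (h.exists_val_eq hm hf y).choose_spec.symm).trans (val_add _ _).symm

@[simp]
lemma val_awayHom (h : AwayDominates 𝒜 ℬ) {f : A} {m : ℕ} (hm : 0 < m) (hf : f ∈ ℬ m)
    (x : Away 𝒜 f) : (h.awayHom hm hf x).val = x.val :=
  (h.exists_val_eq hm hf x).choose_spec

lemma awayHom_comp_awayHom (h : AwayDominates 𝒜 ℬ) (h' : AwayDominates ℬ 𝒜) {f : A} {m d : ℕ}
    (hm : 0 < m) (hf : f ∈ ℬ m) (hd : 0 < d) (hf' : f ∈ 𝒜 d) :
    (h'.awayHom hd hf').comp (h.awayHom hm hf) = RingHom.id _ :=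
  RingHom.ext fun x ↦ val_injective _ <| by simp

lemma awayHom_comp_awayMap (h : AwayDominates 𝒜 ℬ) {f g x : A} {m n d : ℕ}
    (hm : 0 < m) (hf : f ∈ ℬ m) (hg : g ∈ ℬ n) (hg' : g ∈ 𝒜 d) (hx : x = f * g)
    {l : ℕ} (hl : 0 < l) (hxl : x ∈ ℬ l) :
    (h.awayHom hl hxl).comp (awayMap 𝒜 hg' hx) =
      (awayMap ℬ hg hx).comp (h.awayHom hm hf) :=
  RingHom.ext fun y ↦ val_injective _ <| by simp [val_awayMap]

/-- The composite `D₊(f) ⊆ Proj ℬ ⟶ Spec (A_f)₀ ⟶ Proj 𝒜`. -/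
noncomputable def chart (h : AwayDominates 𝒜 ℬ) {f : A} {m : ℕ} (hm : 0 < m) (hf : f ∈ ℬ m) :
    Spec (.of (Away ℬ f)) ⟶ Proj 𝒜 :=
  Spec.map (CommRingCat.ofHom (h.awayHom hm hf)) ≫
    Proj.awayι 𝒜 f (h.exists_mem hm hf).choose_spec.2 (h.exists_mem hm hf).choose_spec.1

lemma chart_eq (h : AwayDominates 𝒜 ℬ) {f : A} {m d : ℕ} (hm : 0 < m) (hf : f ∈ ℬ m)
    (hd : 0 < d) (hf' : f ∈ 𝒜 d) :
    h.chart hm hf =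
      Spec.map (CommRingCat.ofHom (h.awayHom hm hf)) ≫ Proj.awayι 𝒜 f hf' hd :=
  rfl

lemma awayMap_chart (h : AwayDominates 𝒜 ℬ) {f g x : A} {m n l : ℕ}
    (hm : 0 < m) (hf : f ∈ ℬ m) (hn : 0 < n) (hg : g ∈ ℬ n) (hx : x = f * g)
    (hl : 0 < l) (hxl : x ∈ ℬ l) :
    Spec.map (CommRingCat.ofHom (awayMap ℬ hg hx)) ≫ h.chart hm hf = h.chart hl hxl := by
  obtain ⟨d, hd, hf'⟩ := h.exists_mem hm hf
  obtain ⟨e, he, hg'⟩ := h.exists_mem hn hg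
  rw [h.chart_eq hm hf hd hf', h.chart_eq hl hxl (Nat.add_pos_left hd e)
      (hx ▸ SetLike.mul_mem_graded hf' hg'), ← Proj.SpecMap_awayMap_awayι 𝒜 hf' hd hg' hx,
    ← Spec.map_comp_assoc, ← Spec.map_comp_assoc, ← CommRingCat.ofHom_comp,
    ← CommRingCat.ofHom_comp, h.awayHom_comp_awayMap hm hf hg hg' hx hl hxl]

lemma pullback_fst_chart (h : AwayDominates 𝒜 ℬ) {f g : A} {m n : ℕ}
    (hm : 0 < m) (hf : f ∈ ℬ m) (hn : 0 < n) (hg : g ∈ ℬ n) :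
    pullback.fst (Proj.awayι ℬ f hf hm) (Proj.awayι ℬ g hg hn) ≫ h.chart hm hf =
      pullback.snd (Proj.awayι ℬ f hf hm) (Proj.awayι ℬ g hg hn) ≫ h.chart hn hg := by
  have hfg := SetLike.mul_mem_graded hf hg
  have hmn : 0 < m + n := Nat.add_pos_left hm n
  rw [← cancel_epi (Proj.pullbackAwayιIso ℬ hf hm hg hn rfl).inv,
    Proj.pullbackAwayιIso_inv_fst_assoc, Proj.pullbackAwayιIso_inv_snd_assoc,
    h.awayMap_chart hm hf hn hg rfl hmn hfg,
    h.awayMap_chart hn hg hm hf (mul_comm _ _) hmn hfg]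

/-- The morphism `Proj ℬ ⟶ Proj 𝒜` glued from the charts. -/
noncomputable def projHom (h : AwayDominates 𝒜 ℬ) : Proj ℬ ⟶ Proj 𝒜 :=
  (Proj.affineOpenCover ℬ).openCover.glueMorphisms (fun s ↦ h.chart s.1.2 s.2.2)
    fun s t ↦ h.pullback_fst_chart s.1.2 s.2.2 t.1.2 t.2.2

lemma awayι_projHom (h : AwayDominates 𝒜 ℬ) {f : A} {m d : ℕ} (hm : 0 < m) (hf : f ∈ ℬ m)
    (hd : 0 < d) (hf' : f ∈ 𝒜 d) :
    Proj.awayι ℬ f hf hm ≫ h.projHom =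
      Spec.map (CommRingCat.ofHom (h.awayHom hm hf)) ≫ Proj.awayι 𝒜 f hf' hd :=
  (Proj.affineOpenCover ℬ).openCover.ι_glueMorphisms _ _ ⟨⟨m, hm⟩, ⟨f, hf⟩⟩

lemma awayι_projHom_projHom (h : AwayDominates 𝒜 ℬ) (h' : AwayDominates ℬ 𝒜) {f : A} {m : ℕ}
    (hm : 0 < m) (hf : f ∈ ℬ m) :
    Proj.awayι ℬ f hf hm ≫ h.projHom ≫ h'.projHom = Proj.awayι ℬ f hf hm := by
  obtain ⟨d, hd, hf'⟩ := h.exists_mem hm hf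
  rw [← Category.assoc, h.awayι_projHom hm hf hd hf', Category.assoc, h'.awayι_projHom hd hf' hm hf,
    ← Spec.map_comp_assoc, ← CommRingCat.ofHom_comp, h'.awayHom_comp_awayHom h hd hf' hm hf]
  simp

lemma projHom_comp_projHom (h : AwayDominates 𝒜 ℬ) (h' : AwayDominates ℬ 𝒜) :
    h.projHom ≫ h'.projHom = 𝟙 (Proj ℬ) :=
  (Proj.affineOpenCover ℬ).openCover.hom_ext _ _ fun s ↦
    (h.awayι_projHom_projHom h' s.1.2 s.2.2).trans (Category.comp_id _).symm

/-- Gradings which dominate each other have isomorphic `Proj`. -/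
noncomputable def projIso (h : AwayDominates 𝒜 ℬ) (h' : AwayDominates ℬ 𝒜) : Proj 𝒜 ≅ Proj ℬ where
  hom := h'.projHom
  inv := h.projHom
  hom_inv_id := h'.projHom_comp_projHom h
  inv_hom_id := h.projHom_comp_projHom h'

lemma of_mul_degree {q : ℕ} (h : ∀ m, ∀ a ∈ 𝒜 m, a ∈ ℬ (q * m))
    (h' : ∀ m, ∀ a ∈ ℬ m, a ≠ 0 → ∃ d, q * d = m ∧ a ∈ 𝒜 d) : AwayDominates 𝒜 ℬ where
  exists_mem {f m} hm hf := by
    by_cases hf0 : f = 0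
    · exact ⟨1, one_pos, hf0 ▸ zero_mem _⟩
    · obtain ⟨d, rfl, hd⟩ := h' m f hf hf0
      exact ⟨d, Nat.pos_of_mul_pos_left hm, hd⟩
  exists_val_eq _ _ x := by
    obtain ⟨⟨i, ⟨a, ha⟩, ⟨b, hb⟩, hbf⟩, rfl⟩ := mk_surjective x
    exact ⟨HomogeneousLocalization.mk ⟨q * i, ⟨a, h i a ha⟩, ⟨b, h i b hb⟩, hbf⟩, rfl⟩

lemma of_mul_degree_symm {q : ℕ} (hq : 0 < q) (h : ∀ m, ∀ a ∈ 𝒜 m, a ∈ ℬ (q * m))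
    (h' : ∀ m, ∀ a ∈ ℬ m, a ≠ 0 → ∃ d, q * d = m ∧ a ∈ 𝒜 d) : AwayDominates ℬ 𝒜 where
  exists_mem {f m} hm hf := ⟨q * m, Nat.mul_pos hq hm, h m f hf⟩
  exists_val_eq {f _} _ _ x := by
    obtain ⟨⟨i, ⟨a, ha⟩, ⟨b, hb⟩, hbf⟩, rfl⟩ := mk_surjective x
    by_cases ha0 : a = 0
    · subst ha0
      exact ⟨0, by simp [Localization.mk_zero]⟩
    by_cases hb0 : b = 0
    · subst hb0
      have : Subsingleton (Localization.Away f) :=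
        (IsLocalization.subsingleton_iff (M := .powers f)).mpr hbf
      exact ⟨0, Subsingleton.elim _ _⟩
    obtain ⟨d, rfl, hd⟩ := h' i a ha ha0
    obtain ⟨e, he, hbe⟩ := h' _ b hb hb0
    obtain rfl := Nat.eq_of_mul_eq_mul_left hq he
    exact ⟨HomogeneousLocalization.mk ⟨e, ⟨a, hd⟩, ⟨b, hbe⟩, hbf⟩, rfl⟩

end AwayDominates

end Regrading

lemma weight_const_mul {ι : Type*} (q : ℕ) (w : ι → ℕ) (d : ι →₀ ℕ) :
    Finsupp.weight (fun i ↦ q * w i) d = q * Finsupp.weight w d := by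
  simp [Finsupp.weight_apply, Finsupp.sum, Finset.mul_sum, mul_left_comm]

theorem stmt_1 (k : Type) [Field k] [CharZero k] (n : ℕ) (hn : 1 ≤ n)
    (w : Fin (n + 1) → ℕ) (hw : ∀ i, 0 < w i) (q : ℕ) (hq : 0 < q) :
    Nonempty
      (Proj (weightedHomogeneousSubmodule k w) ≅
        Proj (weightedHomogeneousSubmodule k (fun i => q * w i))) := by
  have h : ∀ m, ∀ a ∈ weightedHomogeneousSubmodule k w m,
      a ∈ weightedHomogeneousSubmodule k (fun i ↦ q * w i) (q * m) := fun m a ha d hd ↦ by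
    rw [weight_const_mul, ha hd]
  have h' : ∀ m, ∀ a ∈ weightedHomogeneousSubmodule k (fun i ↦ q * w i) m, a ≠ 0 →
      ∃ d, q * d = m ∧ a ∈ weightedHomogeneousSubmodule k w d := fun m a ha ha0 ↦ by
    obtain ⟨c, hc⟩ := exists_coeff_ne_zero ha0
    refine ⟨Finsupp.weight w c, by rw [← weight_const_mul, ha hc], fun d hd ↦ ?_⟩
    apply Nat.eq_of_mul_eq_mul_left hq
    rw [← weight_const_mul, ← weight_const_mul, ha hc, ha hd]
  exact ⟨(AwayDominates.of_mul_degree h h').projIso (AwayDominates.of_mul_degree_symm hq h h')⟩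
end

section
/- Let n ≥ 1 and let a : Fin (n+1) → ℕ be such that a i > 0 for all i and the gcd of all the values a i (over Finset.univ) equals 1. For each index i, set d i = Finset.gcd (Finset.univ.erase i) a and e i = Finset.lcm (Finset.univ.erase i) d. Then for every index i, e i divides a i. -/
theorem stmt_3 (n : ℕ) (hn : 1 ≤ n) (a : Fin (n + 1) → ℕ)
    (ha : ∀ i, 0 < a i) (hgcd : Finset.gcd Finset.univ a = 1)
    (d e : Fin (n + 1) → ℕ)
    (hd : ∀ i, d i = Finset.gcd (Finset.univ.erase i) a)
    (he : ∀ i, e i = Finset.lcm (Finset.univ.erase i) d) :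
    ∀ i, e i ∣ a i := by
  intro i
  rw [he]
  refine Finset.lcm_dvd fun j hj => ?_
  rw [hd]
  exact Finset.gcd_dvd (Finset.mem_erase.2 ⟨(Finset.ne_of_mem_erase hj).symm, Finset.mem_univ i⟩)
end

section
/- Let n ≥ 1 and let a : Fin (n+1) → ℕ be such that a i > 0 for all i and the gcd of all the values a i (over Finset.univ) equals 1. For each index i, set d i = Finset.gcd (Finset.univ.erase i) a and e i = Finset.lcm (Finset.univ.erase i) d. Then for every index i, the numbers e i and d i are coprime, and e i * d i = Finset.lcm Finset.univ d. -/
theorem Finset.coprime_gcd_erase {ι : Type*} [DecidableEq ι] {s : Finset ι} {a : ι → ℕ}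
    (h : s.gcd a = 1) {i j : ι} (hij : i ≠ j) :
    Nat.Coprime ((s.erase i).gcd a) ((s.erase j).gcd a) := by
  refine Nat.dvd_one.mp (h ▸ Finset.dvd_gcd fun k hk => ?_)
  by_cases hki : k = i
  · exact (Nat.gcd_dvd_right _ _).trans
      (Finset.gcd_dvd (Finset.mem_erase.mpr ⟨hki ▸ hij, hk⟩))
  · exact (Nat.gcd_dvd_left _ _).trans (Finset.gcd_dvd (Finset.mem_erase.mpr ⟨hki, hk⟩))

theorem Finset.coprime_lcm_left {ι : Type*} {s : Finset ι} {f : ι → ℕ} {m : ℕ}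
    (h : ∀ i ∈ s, Nat.Coprime (f i) m) : Nat.Coprime (s.lcm f) m :=
  Nat.Coprime.of_dvd_left (Finset.lcm_dvd fun _ hi => Finset.dvd_prod_of_mem f hi)
    (Nat.Coprime.prod_left h)

theorem stmt_4 (n : ℕ) (hn : 1 ≤ n) (a : Fin (n + 1) → ℕ)
    (ha : ∀ i, 0 < a i) (hgcd : Finset.gcd Finset.univ a = 1)
    (d e : Fin (n + 1) → ℕ)
    (hd : ∀ i, d i = Finset.gcd (Finset.univ.erase i) a)
    (he : ∀ i, e i = Finset.lcm (Finset.univ.erase i) d) :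
    ∀ i, Nat.Coprime (e i) (d i) ∧ e i * d i = Finset.lcm Finset.univ d := by
  intro i
  have hcop : Nat.Coprime (e i) (d i) := by
    rw [he]
    refine Finset.coprime_lcm_left fun j hj => ?_
    rw [hd, hd]
    exact Finset.coprime_gcd_erase hgcd (Finset.ne_of_mem_erase hj)
  refine ⟨hcop, ?_⟩
  rw [← Finset.insert_erase (Finset.mem_univ i), Finset.lcm_insert, ← he, mul_comm]
  exact hcop.symm.lcm_eq_mul.symm
end

section
/- Let n ≥ 1 and let a : Fin (n+1) → ℕ be such that a i > 0 for all i and the gcd of all the values a i (over Finset.univ) equals 1. For each index i, set d i = Finset.gcd (Finset.univ.erase i) a, e i = Finset.lcm (Finset.univ.erase i) d, and b i = a i / e i (this is an exact division since e i divides a i). Then for every index i, Finset.gcd (Finset.univ.erase i) b = 1; that is, the weights b are well-formed. -/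
theorem stmt_5 (n : ℕ) (hn : 1 ≤ n) (a : Fin (n + 1) → ℕ)
    (ha : ∀ i, 0 < a i) (hgcd : Finset.gcd Finset.univ a = 1)
    (d e b : Fin (n + 1) → ℕ)
    (hd : ∀ i, d i = Finset.gcd (Finset.univ.erase i) a)
    (he : ∀ i, e i = Finset.lcm (Finset.univ.erase i) d)
    (hb : ∀ i, b i = a i / e i) :
    ∀ i, Finset.gcd (Finset.univ.erase i) b = 1 := by
  intro i
  have hda : ∀ k j, j ≠ k → d k ∣ a j := fun k j hjk => by
    rw [hd]
    exact Finset.gcd_dvd (by simpa using hjk)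
  have hea : ∀ j, e j ∣ a j := fun j => by
    rw [he]
    exact Finset.lcm_dvd fun k hk => hda k j (Finset.ne_of_mem_erase hk).symm
  have hde : ∀ j, j ≠ i → d i ∣ e j := fun j hj => by
    rw [he]
    exact Finset.dvd_lcm (by simpa using hj.symm)
  have : Nontrivial (Fin (n + 1)) := Fin.nontrivial_iff_two_le.2 (by omega)
  obtain ⟨j, hj⟩ := exists_ne i
  have hpos : 0 < d i := Nat.pos_of_dvd_of_pos (hda i j hj) (ha j)
  have hmul : Finset.gcd (Finset.univ.erase i) b * d i ∣ d i := by
    conv_rhs => rw [hd]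
    refine Finset.dvd_gcd fun k hk => ?_
    have hk' : b k * e k = a k := by rw [hb, Nat.div_mul_cancel (hea k)]
    rw [← hk']
    exact mul_dvd_mul (Finset.gcd_dvd hk) (hde k (Finset.ne_of_mem_erase hk))
  refine Nat.dvd_one.1 (Nat.dvd_of_mul_dvd_mul_right hpos ?_)
  rwa [one_mul]
end

section
/- Let k be a field of characteristic zero, let n ≥ 1, and let a : Fin (n+1) → ℕ with a i > 0 for all i. Then there exists b : Fin (n+1) → ℕ with b i > 0 for all i, satisfying the well-formedness condition Finset.gcd (Finset.univ.erase i) b = 1 for every index i, such that the scheme Proj of MvPolynomial (Fin (n+1)) k graded by the weighted homogeneous submodules with respect to a is isomorphic, as a scheme, to the Proj of MvPolynomial (Fin (n+1)) k graded by the weighted homogeneous submodules with respect to b. -/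
open MvPolynomial AlgebraicGeometry

attribute [local instance] MvPolynomial.weightedGradedAlgebra

namespace HomogeneousLocalization

variable {A B σ τ : Type*} [CommRing A] [CommRing B]
  [SetLike σ A] [AddSubgroupClass σ A] [SetLike τ B] [AddSubgroupClass τ B]
  (𝒜 : ℕ → σ) [GradedRing 𝒜] (ℬ : ℕ → τ) [GradedRing ℬ]

variable {𝒜 ℬ} in
/-- If `φ : A →+* B` identifies `𝒜` with the `D`-th Veronese subring of `ℬ`, then it induces
isomorphisms `A_{(f)} ≃ B_{(φ f)}`. -/
lemma Away.exists_ringEquiv_of_veronese {φ : A →+* B} (hφ : Function.Injective φ) {D : ℕ}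
    (hD : 0 < D) (hφ𝒜 : ∀ i, ∀ a ∈ 𝒜 i, φ a ∈ ℬ (D * i))
    (hφℬ : ∀ i, ∀ b ∈ ℬ (D * i), ∃ a ∈ 𝒜 i, φ a = b) {f : A} (hf : ∃ d, f ∈ 𝒜 d) :
    ∃ e : Away 𝒜 f ≃+* Away ℬ (φ f),
      ∀ (d : ℕ) (hf : f ∈ 𝒜 d) (n : ℕ) (a : A) (ha : a ∈ 𝒜 (n • d)),
        e (Away.mk 𝒜 hf n a ha) = Away.mk ℬ (hφ𝒜 d f hf) n (φ a)
          (by simpa [mul_left_comm] using hφ𝒜 _ a ha) := by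
  let h : Away 𝒜 f →+* Localization.Away (φ f) :=
    (Localization.awayMap φ f).comp (algebraMap (Away 𝒜 f) (Localization.Away f))
  have h_mk (d : ℕ) (hf : f ∈ 𝒜 d) (n : ℕ) (a : A) (ha : a ∈ 𝒜 (n • d)) :
      h (Away.mk 𝒜 hf n a ha) = (Away.mk ℬ (hφ𝒜 d f hf) n (φ a)
        (by simpa [mul_left_comm] using hφ𝒜 _ a ha)).val := by
    simp only [h, RingHom.comp_apply, algebraMap_apply, Away.val_mk, Localization.awayMap,
      IsLocalization.Away.map, Localization.mk_eq_mk', IsLocalization.map_mk', map_pow]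
  have h_inj : Function.Injective h := by
    have : Function.Injective (Localization.awayMap φ f) := by
      have : IsLocalization ((Submonoid.powers f).map φ) (Localization.Away (φ f)) := by
        rw [Submonoid.map_powers]
        infer_instance
      exact IsLocalization.map_injective_of_injective (.powers f) _ _ hφ
    exact this.comp (val_injective _)
  have h_range : h.range = (algebraMap (Away ℬ (φ f)) (Localization.Away (φ f))).range := by
    obtain ⟨d, hf⟩ := hf
    apply le_antisymm
    · rintro _ ⟨x, rfl⟩
      obtain ⟨n, a, ha, rfl⟩ := Away.mk_surjective 𝒜 hf x
      exact ⟨Away.mk ℬ (hφ𝒜 d f hf) n (φ a) _, (h_mk d hf n a ha).symm⟩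
    · rintro _ ⟨y, rfl⟩
      obtain ⟨n, b, hb, rfl⟩ := Away.mk_surjective ℬ (hφ𝒜 d f hf) y
      obtain ⟨a, ha, hab⟩ := hφℬ ((D * n) • d) (b * φ f ^ ((D - 1) * n)) <| by
        convert! SetLike.mul_mem_graded hb (SetLike.pow_mem_graded ((D - 1) * n) (hφ𝒜 d f hf))
          using 2
        obtain ⟨D, rfl⟩ := Nat.exists_eq_succ_of_ne_zero hD.ne'
        simp
        ring
      refine ⟨Away.mk 𝒜 hf (D * n) a ha, ?_⟩
      rw [h_mk, algebraMap_apply, Away.val_mk, Away.val_mk, Localization.mk_eq_mk_iff,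
        Localization.r_iff_exists]
      refine ⟨1, ?_⟩
      obtain ⟨D, rfl⟩ := Nat.exists_eq_succ_of_ne_zero hD.ne'
      simp [hab]
      ring
  let e₁ := RingEquiv.ofLeftInverse (f := h) (h := h_inj.hasLeftInverse.choose_spec)
  let e₂ := RingEquiv.ofLeftInverse (f := algebraMap (Away ℬ (φ f)) (Localization.Away (φ f)))
    (h := (val_injective _).hasLeftInverse.choose_spec)
  refine ⟨(e₁.trans (RingEquiv.subringCongr h_range)).trans e₂.symm, fun d hf n a ha ↦ ?_⟩
  rw [RingEquiv.trans_apply, RingEquiv.symm_apply_eq]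
  ext
  exact h_mk d hf n a ha

end HomogeneousLocalization

namespace AlgebraicGeometry.Proj

open CategoryTheory HomogeneousLocalization

universe u

variable {A B : Type u} {σ τ : Type*} [CommRing A] [CommRing B]
  [SetLike σ A] [AddSubgroupClass σ A] [SetLike τ B] [AddSubgroupClass τ B]
  (𝒜 : ℕ → σ) [GradedRing 𝒜] (ℬ : ℕ → τ) [GradedRing ℬ]

lemma awayι_eq_awayι {f : A} {m n : ℕ} (hf : f ∈ 𝒜 m) (hm : 0 < m) (hf' : f ∈ 𝒜 n) (hn : 0 < n) :
    awayι 𝒜 f hf hm = awayι 𝒜 f hf' hn := by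
  rw [awayι, awayι, Iso.inv_comp_eq, basicOpenIsoSpec_hom, ← basicOpenIsoSpec_hom _ _ hf' hn,
    Iso.hom_inv_id_assoc]

/-- The affine open cover of `Proj 𝒜` by the `D₊(f i)`, when these cover the whole space. -/
noncomputable def affineOpenCoverOfISup {ι : Type*} (f : ι → A) {m : ι → ℕ}
    (hf : ∀ i, f i ∈ 𝒜 (m i)) (hm : ∀ i, 0 < m i) (h : ⨆ i, basicOpen 𝒜 (f i) = ⊤) :
    (Proj 𝒜).AffineOpenCover where
  I₀ := ι
  X i := .of (Away 𝒜 (f i))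
  f i := awayι 𝒜 (f i) (hf i) (hm i)
  idx x := (TopologicalSpace.Opens.mem_iSup.mp (h.ge (Set.mem_univ x))).choose
  covers x := by
    change x ∈ (awayι 𝒜 _ _ _).opensRange
    rw [opensRange_awayι]
    exact (TopologicalSpace.Opens.mem_iSup.mp (h.ge (Set.mem_univ x))).choose_spec

lemma hom_ext_of_iSup_basicOpen_eq_top {ι : Type*} (f : ι → A) {m : ι → ℕ}
    (hf : ∀ i, f i ∈ 𝒜 (m i)) (hm : ∀ i, 0 < m i) (h : ⨆ i, basicOpen 𝒜 (f i) = ⊤)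
    {Y : Scheme.{u}} (F G : Proj 𝒜 ⟶ Y)
    (hFG : ∀ i, awayι 𝒜 (f i) (hf i) (hm i) ≫ F = awayι 𝒜 (f i) (hf i) (hm i) ≫ G) : F = G :=
  (affineOpenCoverOfISup 𝒜 f hf hm h).openCover.hom_ext _ _ hFG

lemma exists_hom_of_iSup_basicOpen_eq_top {ι : Type*} (f : ι → A) {m : ι → ℕ}
    (hf : ∀ i, f i ∈ 𝒜 (m i)) (hm : ∀ i, 0 < m i) (h : ⨆ i, basicOpen 𝒜 (f i) = ⊤)
    (x : ι → ι → A) (hx : ∀ i j, x i j = f i * f j)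
    {Y : Scheme.{u}} (g : ∀ i, Spec (.of (Away 𝒜 (f i))) ⟶ Y)
    (hg : ∀ i j, Spec.map (CommRingCat.ofHom (awayMap 𝒜 (hf j) (hx i j))) ≫ g i =
      Spec.map (CommRingCat.ofHom (awayMap 𝒜 (hf i) ((hx i j).trans (mul_comm _ _)))) ≫ g j) :
    ∃ F : Proj 𝒜 ⟶ Y, ∀ i, awayι 𝒜 (f i) (hf i) (hm i) ≫ F = g i := by
  have compat (i j : ι) :
      Limits.pullback.fst (awayι 𝒜 (f i) (hf i) (hm i)) (awayι 𝒜 (f j) (hf j) (hm j)) ≫ g i =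
      Limits.pullback.snd (awayι 𝒜 (f i) (hf i) (hm i)) (awayι 𝒜 (f j) (hf j) (hm j)) ≫ g j := by
    rw [← pullbackAwayιIso_hom_SpecMap_awayMap_left 𝒜 (hf i) (hm i) (hf j) (hm j) (hx i j),
      ← pullbackAwayιIso_hom_SpecMap_awayMap_right 𝒜 (hf i) (hm i) (hf j) (hm j) (hx i j),
      Category.assoc, Category.assoc, hg]
  let U := (affineOpenCoverOfISup 𝒜 f hf hm h).openCover
  exact ⟨U.glueMorphisms g compat, fun i ↦ U.ι_glueMorphisms g _ i⟩

lemma iSup_basicOpen_homogeneous_eq_top :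
    ⨆ x : {x : ℕ × A // 0 < x.1 ∧ x.2 ∈ 𝒜 x.1}, basicOpen 𝒜 x.1.2 = ⊤ := by
  refine top_le_iff.mp fun x _ ↦ ?_
  obtain ⟨i, hi⟩ := (affineOpenCover 𝒜).openCover.exists_eq x
  refine TopologicalSpace.Opens.mem_iSup.mpr ⟨⟨(i.1, i.2), i.1.2, i.2.2⟩, ?_⟩
  rw [← opensRange_awayι 𝒜 _ i.2.2 i.1.2]
  exact hi

/-- If `φ : A →+* B` identifies `A` with the `D`-th Veronese subring of `B`, then it induces an
isomorphism on `Proj`. -/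
theorem nonempty_iso_of_veronese {φ : A →+* B} (hφ : Function.Injective φ) {D : ℕ}
    (hD : 0 < D) (hφ𝒜 : ∀ i, ∀ a ∈ 𝒜 i, φ a ∈ ℬ (D * i))
    (hφℬ : ∀ i, ∀ b ∈ ℬ (D * i), ∃ a ∈ 𝒜 i, φ a = b) :
    Nonempty (Proj ℬ ≅ Proj 𝒜) := by
  let ι := {x : ℕ × A // 0 < x.1 ∧ x.2 ∈ 𝒜 x.1}
  let f (i : ι) : A := i.1.2
  have hf (i : ι) : f i ∈ 𝒜 i.1.1 := i.2.2
  have hm (i : ι) : 0 < i.1.1 := i.2.1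
  have hφf (i : ι) : φ (f i) ∈ ℬ (D * i.1.1) := hφ𝒜 _ _ (hf i)
  have hφm (i : ι) : 0 < D * i.1.1 := Nat.mul_pos hD (hm i)
  have h𝒜 : ⨆ i, basicOpen 𝒜 (f i) = ⊤ := iSup_basicOpen_homogeneous_eq_top 𝒜
  have hℬ : ⨆ i, basicOpen ℬ (φ (f i)) = ⊤ := by
    rw [← top_le_iff, ← iSup_basicOpen_homogeneous_eq_top ℬ, iSup_le_iff]
    rintro ⟨⟨n, b⟩, hn, hb⟩
    obtain ⟨a, ha, hab⟩ := hφℬ n (b ^ D) (by simpa using SetLike.pow_mem_graded D hb)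
    rw [← basicOpen_pow ℬ b D hD, ← hab]
    exact le_iSup (fun i : ι ↦ basicOpen ℬ (φ (f i))) ⟨(n, a), hn, ha⟩
  choose e he using fun x : {x : A // ∃ d, x ∈ 𝒜 d} ↦
    Away.exists_ringEquiv_of_veronese hφ hD hφ𝒜 hφℬ x.2
  let p (i j : ι) : {x : A // ∃ d, x ∈ 𝒜 d} :=
    ⟨f i * f j, _, SetLike.mul_mem_graded (hf i) (hf j)⟩
  let q (i : ι) : {x : A // ∃ d, x ∈ 𝒜 d} := ⟨f i, _, hf i⟩
  have nat₁ (i j : ι) :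
      (e (p i j) : Away 𝒜 (f i * f j) →+* Away ℬ (φ (f i * f j))).comp
        (awayMap 𝒜 (hf j) rfl) =
      (awayMap ℬ (hφf j) (map_mul φ (f i) (f j))).comp
        (e (q i) : Away 𝒜 (f i) →+* Away ℬ (φ (f i))) := by
    ext y
    obtain ⟨n, a, ha, rfl⟩ := Away.mk_surjective 𝒜 (hf i) y
    simp [he, p, q]
  have nat₂ (i j : ι) :
      (e (p i j) : Away 𝒜 (f i * f j) →+* Away ℬ (φ (f i * f j))).comp
        (awayMap 𝒜 (hf i) (mul_comm _ _)) =
      (awayMap ℬ (hφf i) ((map_mul φ (f i) (f j)).trans (mul_comm _ _))).comp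
        (e (q j) : Away 𝒜 (f j) →+* Away ℬ (φ (f j))) := by
    ext y
    obtain ⟨n, a, ha, rfl⟩ := Away.mk_surjective 𝒜 (hf j) y
    simp [he, p, q]
  let E (x : {x : A // ∃ d, x ∈ 𝒜 d}) : Spec (.of (Away ℬ (φ x))) ≅ Spec (.of (Away 𝒜 x.1)) :=
    Scheme.Spec.mapIso (e x).toCommRingCatIso.op
  have natE₁ (i j : ι) : Spec.map (CommRingCat.ofHom (awayMap ℬ (hφf j) (map_mul φ (f i) (f j)))) ≫
      (E (q i)).hom = (E (p i j)).hom ≫ Spec.map (CommRingCat.ofHom (awayMap 𝒜 (hf j) rfl)) := by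
    have := congrArg (Spec.map <| CommRingCat.ofHom ·) (nat₁ i j).symm
    simp only [CommRingCat.ofHom_comp, Spec.map_comp] at this
    exact this
  have natE₂ (i j : ι) : Spec.map (CommRingCat.ofHom (awayMap ℬ (hφf i)
      ((map_mul φ (f i) (f j)).trans (mul_comm _ _)))) ≫ (E (q j)).hom =
      (E (p i j)).hom ≫ Spec.map (CommRingCat.ofHom (awayMap 𝒜 (hf i) (mul_comm _ _))) := by
    have := congrArg (Spec.map <| CommRingCat.ofHom ·) (nat₂ i j).symm
    simp only [CommRingCat.ofHom_comp, Spec.map_comp] at this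
    exact this
  obtain ⟨F, hF⟩ := exists_hom_of_iSup_basicOpen_eq_top ℬ (fun i ↦ φ (f i)) hφf hφm hℬ
    (fun i j ↦ φ (f i * f j)) (fun i j ↦ map_mul φ _ _)
    (fun i ↦ (E (q i)).hom ≫ awayι 𝒜 (f i) (hf i) (hm i)) <| fun i j ↦ by
      rw [reassoc_of% natE₁ i j, reassoc_of% natE₂ i j, SpecMap_awayMap_awayι,
        SpecMap_awayMap_awayι]
      exact congrArg (_ ≫ ·) (awayι_eq_awayι ..)
  obtain ⟨G, hG⟩ := exists_hom_of_iSup_basicOpen_eq_top 𝒜 f hf hm h𝒜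
    (fun i j ↦ f i * f j) (fun i j ↦ rfl)
    (fun i ↦ (E (q i)).inv ≫ awayι ℬ (φ (f i)) (hφf i) (hφm i)) <| fun i j ↦ by
      rw [← cancel_epi (E (p i j)).hom, ← reassoc_of% natE₁ i j, ← reassoc_of% natE₂ i j]
      rw [Iso.hom_inv_id_assoc, Iso.hom_inv_id_assoc, SpecMap_awayMap_awayι, SpecMap_awayMap_awayι]
      exact awayι_eq_awayι ..
  refine ⟨⟨F, G, ?_, ?_⟩⟩
  · refine hom_ext_of_iSup_basicOpen_eq_top ℬ (fun i ↦ φ (f i)) hφf hφm hℬ _ _ fun i ↦ ?_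
    rw [reassoc_of% hF, hG, Iso.hom_inv_id_assoc, Category.comp_id]
  · refine hom_ext_of_iSup_basicOpen_eq_top 𝒜 f hf hm h𝒜 _ _ fun i ↦ ?_
    rw [reassoc_of% hG, hF, Iso.inv_hom_id_assoc, Category.comp_id]

end AlgebraicGeometry.Proj

namespace MvPolynomial

variable {ι R : Type*} [CommSemiring R]

/-- The `R`-algebra endomorphism of `R[Xᵢ]` sending `Xᵢ` to `Xᵢ ^ eᵢ`. -/
noncomputable def powVars (R : Type*) [CommSemiring R] (e : ι → ℕ) :
    MvPolynomial ι R →ₐ[R] MvPolynomial ι R :=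
  aeval fun i ↦ X i ^ e i

lemma powVars_monomial (e : ι → ℕ) (m : ι →₀ ℕ) (c : R) :
    powVars R e (monomial m c) = monomial (e • m) c := by
  rw [powVars, aeval_monomial, monomial_eq (s := e • m)]
  congr 1
  rw [Finsupp.prod_of_support_subset (s := m.support) (e • m) (fun i ↦ by simp) _ (by simp)]
  simp [Finsupp.prod, ← pow_mul]

lemma coeff_powVars {e : ι → ℕ} (he : ∀ i, 0 < e i) (m : ι →₀ ℕ) (p : MvPolynomial ι R) :
    coeff (e • m) (powVars R e p) = coeff m p := by
  classical
  induction p using MvPolynomial.induction_on' with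
  | monomial l c =>
    have h : e • l = e • m ↔ l = m := by
      simp [Finsupp.ext_iff, (he _).ne']
    simp [powVars_monomial, h]
  | add p q hp hq => simp [hp, hq]

lemma powVars_injective {e : ι → ℕ} (he : ∀ i, 0 < e i) : Function.Injective (powVars R e) :=
  fun p q h ↦ by
    ext m
    rw [← coeff_powVars he, h, coeff_powVars he]

lemma weight_smul {a b e : ι → ℕ} {D : ℕ} (h : ∀ i, e i * a i = D * b i) (m : ι →₀ ℕ) :
    Finsupp.weight a (e • m) = D * Finsupp.weight b m := by
  rw [Finsupp.weight_apply, Finsupp.weight_apply,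
    Finsupp.sum_of_support_subset (s := m.support) _ (fun i ↦ by simp) _ (by simp),
    Finsupp.sum, Finset.mul_sum]
  refine Finset.sum_congr rfl fun i _ ↦ ?_
  simp [mul_right_comm _ (m i), h]
  ring

lemma powVars_mem_weightedHomogeneousSubmodule {a b e : ι → ℕ} {D : ℕ}
    (h : ∀ i, e i * a i = D * b i) (n : ℕ) (p : MvPolynomial ι R)
    (hp : p ∈ weightedHomogeneousSubmodule R b n) :
    powVars R e p ∈ weightedHomogeneousSubmodule R a (D * n) := by
  rw [p.as_sum, map_sum]
  refine Submodule.sum_mem _ fun m hm ↦ ?_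
  rw [powVars_monomial]
  refine isWeightedHomogeneous_monomial _ _ _ ?_
  rw [weight_smul h, hp (mem_support_iff.mp hm)]

lemma exists_powVars_eq {a b e : ι → ℕ} {D : ℕ} (hD : 0 < D)
    (h : ∀ i, e i * a i = D * b i)
    (hdvd : ∀ m : ι →₀ ℕ, D ∣ Finsupp.weight a m → ∀ i, e i ∣ m i) (n : ℕ) (q : MvPolynomial ι R)
    (hq : q ∈ weightedHomogeneousSubmodule R a (D * n)) :
    ∃ p ∈ weightedHomogeneousSubmodule R b n, powVars R e p = q := by
  have hq' (m : q.support) : ∃ l : ι →₀ ℕ, e • l = m.1 := by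
    refine ⟨Finsupp.onFinset m.1.support (fun i ↦ m.1 i / e i) fun i hi ↦ ?_, ?_⟩
    · exact Finsupp.mem_support_iff.mpr fun h0 ↦ hi (by rw [h0, Nat.zero_div])
    · ext i
      exact Nat.mul_div_cancel' (hdvd m.1 ⟨n, hq (mem_support_iff.mp m.2)⟩ i)
  choose l hl using hq'
  refine ⟨∑ m : q.support, monomial (l m) (coeff m.1 q), Submodule.sum_mem _ fun m _ ↦ ?_, ?_⟩
  · refine isWeightedHomogeneous_monomial _ _ _ (Nat.eq_of_mul_eq_mul_left hD ?_)
    rw [← weight_smul h, hl, hq (mem_support_iff.mp m.2)]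
  · simp only [map_sum, powVars_monomial, hl]
    rw [Finset.sum_coe_sort q.support fun m ↦ monomial m (coeff m q), ← q.as_sum]

end MvPolynomial
/-- Positive weights `a` admit a well-formed `b` such that raising the `i`-th variable to the power
`e i` identifies the polynomial ring graded by `b` with the `D`-th Veronese subring of the one
graded by `a`. -/
lemma exists_wellFormed_weights {ι : Type*} [Fintype ι] [DecidableEq ι] [Nontrivial ι]
    (a : ι → ℕ) (ha : ∀ i, 0 < a i) :
    ∃ (b e : ι → ℕ) (D : ℕ), (∀ i, 0 < b i) ∧ (∀ i, (Finset.univ.erase i).gcd b = 1) ∧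
      0 < D ∧ (∀ i, 0 < e i) ∧ (∀ i, e i * a i = D * b i) ∧
      ∀ m : ι →₀ ℕ, D ∣ Finsupp.weight a m → ∀ i, e i ∣ m i := by
  obtain ⟨i₀⟩ : Nonempty ι := inferInstance
  obtain ⟨c, hc, hgcd⟩ := Finset.extract_gcd a (s := Finset.univ) ⟨i₀, Finset.mem_univ _⟩
  set g := Finset.univ.gcd a
  have hg0 : 0 < g := Nat.pos_of_ne_zero fun h0 ↦
    (ha i₀).ne' (by rw [hc i₀ (Finset.mem_univ _), h0, zero_mul])
  replace hc (i : ι) : a i = g * c i := hc i (Finset.mem_univ _)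
  have hc0 (i : ι) : 0 < c i := Nat.pos_of_ne_zero fun h ↦
    (ha i).ne' (by rw [hc, h, mul_zero])
  let d (i : ι) : ℕ := (Finset.univ.erase i).gcd c
  have hdc {i j : ι} (h : j ≠ i) : d i ∣ c j := Finset.gcd_dvd (by simp [h])
  have hd0 (i : ι) : 0 < d i := by
    obtain ⟨j, hj⟩ := exists_ne i
    exact Nat.pos_of_dvd_of_pos (hdc hj) (hc0 j)
  have hcop (i : ι) : (c i).Coprime (d i) := by
    rw [Nat.Coprime, ← Nat.dvd_one, ← hgcd]
    refine Finset.dvd_gcd fun j _ ↦ ?_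
    by_cases h : j = i
    · exact h ▸ Nat.gcd_dvd_left _ _
    · exact (Nat.gcd_dvd_right _ _).trans (hdc h)
  have hdd {i j : ι} (h : i ≠ j) : (d i).Coprime (d j) :=
    (hcop j).coprime_dvd_left (hdc h.symm)
  have hprod (i : ι) : ∏ j ∈ Finset.univ.erase i, d j ∣ c i :=
    Finset.prod_dvd_of_isRelPrime
      (fun j _ l _ h ↦ Nat.coprime_iff_isRelPrime.mp (hdd h))
      fun j hj ↦ hdc (Finset.ne_of_mem_erase hj).symm
  choose b hb using hprod
  have hD (i : ι) : ∏ j, d j = d i * ∏ j ∈ Finset.univ.erase i, d j :=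
    (Finset.mul_prod_erase _ _ (Finset.mem_univ i)).symm
  refine ⟨b, d, g * ∏ j, d j, fun i ↦ ?_, fun i ↦ ?_, ?_, hd0, fun i ↦ ?_, fun m hm i ↦ ?_⟩
  · exact Nat.pos_of_ne_zero fun h ↦ (hc0 i).ne' (by rw [hb, h, mul_zero])
  · have : d i * (Finset.univ.erase i).gcd b ∣ d i := by
      refine Finset.dvd_gcd fun j hj ↦ ?_
      rw [hb j]
      exact mul_dvd_mul (Finset.dvd_prod_of_mem d (by simpa using (Finset.ne_of_mem_erase hj).symm))
        (Finset.gcd_dvd hj)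
    exact Nat.dvd_one.mp (Nat.dvd_of_mul_dvd_mul_left (hd0 i) (by simpa using this))
  · exact Nat.mul_pos hg0 (Finset.prod_pos fun j _ ↦ hd0 j)
  · rw [hc, hD i, hb i]
    ring
  · have hw : Finsupp.weight a m = g * ∑ j, m j * c j := by
      rw [Finsupp.weight_apply, Finsupp.sum_fintype _ _ (by simp), Finset.mul_sum]
      exact Finset.sum_congr rfl fun j _ ↦ by rw [hc j, smul_eq_mul]; ring
    rw [hw] at hm
    have := (Finset.dvd_prod_of_mem d (Finset.mem_univ i)).trans
      (Nat.dvd_of_mul_dvd_mul_left hg0 hm)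
    rw [← Finset.add_sum_erase _ _ (Finset.mem_univ i), Nat.dvd_add_left] at this
    · exact (hcop i).symm.dvd_of_dvd_mul_right this
    · exact Finset.dvd_sum fun j hj ↦ (hdc (Finset.ne_of_mem_erase hj)).mul_left _

theorem stmt_6 (k : Type) [Field k] [CharZero k] (n : ℕ) (hn : 1 ≤ n)
    (a : Fin (n + 1) → ℕ) (ha : ∀ i, 0 < a i) :
    ∃ b : Fin (n + 1) → ℕ, (∀ i, 0 < b i) ∧
      (∀ i, Finset.gcd (Finset.univ.erase i) b = 1) ∧
      Nonempty
        (Proj (weightedHomogeneousSubmodule k a) ≅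
          Proj (weightedHomogeneousSubmodule k b)) := by
  have : Nontrivial (Fin (n + 1)) := Fin.nontrivial_iff_two_le.mpr (by lia)
  obtain ⟨b, e, D, hb, hgcd, hD, he, h, hdvd⟩ := exists_wellFormed_weights a ha
  exact ⟨b, hb, hgcd, Proj.nonempty_iso_of_veronese (weightedHomogeneousSubmodule k b)
    (weightedHomogeneousSubmodule k a) (φ := (powVars k e : _ →+* _)) (powVars_injective he) hD
    (powVars_mem_weightedHomogeneousSubmodule h) (exists_powVars_eq hD h hdvd)⟩
end

section
/- Let k be a field of characteristic zero, let n ≥ 1, let w : Fin (n+1) → ℕ with w i > 0 for all i, and let s be a nonempty subset (finset) of Fin (n+1) with Finset.gcd s w = 1; write m + 1 = s.card. Let f = ∏_{i ∈ s} X i, a weighted homogeneous element of MvPolynomial (Fin (n+1)) k of degree ∑_{i ∈ s} w i for the grading by MvPolynomial.weightedHomogeneousSubmodule k w. Then the degree-zero part of the localization away from f, namely HomogeneousLocalization.Away (MvPolynomial.weightedHomogeneousSubmodule k w) f, is isomorphic as a ring to MvPolynomial (Fin (n - m)) (AddMonoidAlgebra k (Fin m → ℤ)), i.e. to the polynomial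 ring in n − m variables over the Laurent polynomial ring in m variables over k. -/
open MvPolynomial AlgebraicGeometry

attribute [local instance] MvPolynomial.weightedGradedAlgebra

lemma LinearMap.exists_prod_bijective_of_surjective {ι : Type*} [Fintype ι] {m : ℕ}
    (hm : m + 1 = Fintype.card ι) (W : (ι → ℤ) →ₗ[ℤ] ℤ) (hW : Function.Surjective W) :
    ∃ p : (ι → ℤ) →ₗ[ℤ] (Fin m → ℤ), Function.Bijective (p.prod W) := by
  obtain ⟨c, hc⟩ := hW 1
  have hrank : Module.finrank ℤ (LinearMap.ker W) = m := by
    have h := (LinearMap.ker W).finrank_quotient_add_finrank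
    rw [(W.quotKerEquivOfSurjective hW).finrank_eq, Module.finrank_self,
      Module.finrank_fintype_fun_eq_card] at h
    omega
  let e : LinearMap.ker W ≃ₗ[ℤ] (Fin m → ℤ) :=
    LinearEquiv.ofFinrankEq _ _ (by rw [hrank, Module.finrank_fin_fun])
  let q : (ι → ℤ) →ₗ[ℤ] LinearMap.ker W :=
    (LinearMap.id - W.smulRight c).codRestrict _ fun x ↦ by
      simp [-zsmul_eq_mul, hc]
  have hq (x : ι → ℤ) : (q x : ι → ℤ) = x - W x • c := rfl
  refine ⟨e.toLinearMap ∘ₗ q, fun x y hxy ↦ ?_, fun ⟨g, t⟩ ↦ ⟨e.symm g + t • c, ?_⟩⟩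
  · obtain ⟨h1, h2⟩ := Prod.ext_iff.1 hxy
    have h1' : q x = q y := e.injective h1
    have h2' : W x = W y := h2
    have h3 := congrArg Subtype.val h1'
    rw [hq, hq, h2'] at h3
    exact sub_left_injective h3
  · have hg : W (e.symm g) = 0 := (e.symm g).2
    have hWx : W (e.symm g + t • c) = t := by simp [-zsmul_eq_mul, hg, hc]
    have hqx : q (e.symm g + t • c) = e.symm g := by
      ext1
      rw [hq, hWx, add_sub_cancel_right]
    change (e (q (e.symm g + t • c)), W (e.symm g + t • c)) = (g, t)
    rw [hqx, hWx, e.apply_symm_apply]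

lemma Finset.exists_sum_mul_eq_one_of_gcd_eq_one {σ : Type*} {w : σ → ℕ} {s : Finset σ}
    (hgcd : s.gcd w = 1) : ∃ c : s → ℤ, ∑ i, c i * (w i : ℤ) = 1 := by
  obtain ⟨f, hf⟩ := s.gcd_eq_sum_mul (fun i ↦ (w i : ℤ))
  have h1 : s.gcd (fun i ↦ (w i : ℤ)) = 1 := by
    rw [← Finset.normalize_gcd, normalize_eq_one, Int.isUnit_iff_natAbs_eq, ← Nat.dvd_one,
      ← hgcd]
    exact Finset.dvd_gcd fun i hi ↦
      Int.natCast_dvd_natCast.1 (Int.natAbs_dvd.2 (Finset.gcd_dvd hi))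
  refine ⟨fun i ↦ f i, ?_⟩
  rw [Finset.sum_coe_sort s (fun i ↦ f i * (w i : ℤ)), ← h1, hf]
  simp [mul_comm]

section

variable {σ τ M k : Type*} [AddCommGroup M] [CommRing k]

/-- The ring homomorphism from a polynomial ring to a polynomial ring over a group algebra that
sends the monomial with exponent `a` and coefficient `r` to the monomial with exponent `v a` and
coefficient `r` times the basis element `u a`. -/
noncomputable def MvPolynomial.toGroupAlgebraPolynomial (k : Type*) [CommRing k]
    (u : (σ →₀ ℕ) →+ M) (v : (σ →₀ ℕ) →+ (τ →₀ ℕ)) :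
    MvPolynomial σ k →+* MvPolynomial τ (AddMonoidAlgebra k M) :=
  eval₂Hom (C.comp AddMonoidAlgebra.singleZeroRingHom)
    fun i ↦ monomial (v (.single i 1)) (.single (u (.single i 1)) 1)

namespace MvPolynomial

variable (u : (σ →₀ ℕ) →+ M) (v : (σ →₀ ℕ) →+ (τ →₀ ℕ))

lemma toGroupAlgebraPolynomial_monomial (a : σ →₀ ℕ) (r : k) :
    toGroupAlgebraPolynomial k u v (monomial a r) =
      monomial (v a) (AddMonoidAlgebra.single (u a) r) := by
  have hC (r : k) : toGroupAlgebraPolynomial k u v (C r) = C (AddMonoidAlgebra.single 0 r) := by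
    simp [toGroupAlgebraPolynomial]
  have hone : toGroupAlgebraPolynomial k u v (monomial a 1) =
      monomial (v a) (AddMonoidAlgebra.single (u a) 1) := by
    induction a using Finsupp.induction_linear with
    | zero => rw [← C_apply, hC, map_zero, map_zero, C_apply]
    | add a b ha hb =>
      rw [← mul_one (1 : k), ← monomial_mul, map_mul, ha, hb, monomial_mul]
      simp
    | single i n =>
      rw [← X_pow_eq_monomial, map_pow, ← mul_one n, ← smul_eq_mul, ← Finsupp.smul_single,
        map_nsmul, map_nsmul]
      simp [toGroupAlgebraPolynomial, monomial_pow, AddMonoidAlgebra.single_pow]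
  rw [← mul_one r, ← C_mul_monomial, map_mul, hone, hC, C_mul_monomial]
  simp

variable {u v} {w : σ → ℕ}

lemma eq_zero_of_toGroupAlgebraPolynomial_eq_zero
    (hinj : ∀ a b, Finsupp.weight w a = Finsupp.weight w b → u a = u b → v a = v b → a = b)
    {x : MvPolynomial σ k} {d : ℕ} (hx : IsWeightedHomogeneous w x d)
    (h : toGroupAlgebraPolynomial k u v x = 0) : x = 0 := by
  classical
  ext a
  by_contra ha
  rw [coeff_zero] at ha
  have key : ((toGroupAlgebraPolynomial k u v x).coeff (v a)).coeff (u a) = x.coeff a := by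
    conv_lhs => rw [x.as_sum, map_sum]
    simp only [toGroupAlgebraPolynomial_monomial, coeff_sum, coeff_monomial,
      AddMonoidAlgebra.coeff_sum, Finsupp.finsetSum_apply]
    rw [Finset.sum_eq_single a]
    · simp
    · intro b hb hba
      split_ifs with hv
      · rw [AddMonoidAlgebra.coeff_single, Finsupp.single_apply, if_neg]
        exact fun hu ↦ hba (hinj b a ((hx (mem_support_iff.1 hb)).trans (hx ha).symm) hu hv)
      · simp
    · simp_all
  exact ha (by rw [← key, h]; simp)

theorem nonempty_away_monomial_ringEquiv {e : σ →₀ ℕ} (he : v e = 0)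
    (hinj : ∀ a b, Finsupp.weight w a = Finsupp.weight w b → u a = u b → v a = v b → a = b)
    (hsurj : ∀ g t, ∃ N : ℕ, ∃ a, Finsupp.weight w a = N • Finsupp.weight w e ∧
      u a = g + N • u e ∧ v a = t) :
    Nonempty (HomogeneousLocalization.Away (weightedHomogeneousSubmodule k w) (monomial e 1) ≃+*
      MvPolynomial τ (AddMonoidAlgebra k M)) := by
  let φ := toGroupAlgebraPolynomial k u v
  have hf : (monomial e 1 : MvPolynomial σ k) ∈
      weightedHomogeneousSubmodule k w (Finsupp.weight w e) :=
    isWeightedHomogeneous_monomial w e 1 rfl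
  have hunit : IsUnit (φ (monomial e 1)) := by
    rw [toGroupAlgebraPolynomial_monomial, he]
    refine IsUnit.map (C (σ := τ)) (IsUnit.of_mul_eq_one (AddMonoidAlgebra.single (-u e) 1) ?_)
    simp [AddMonoidAlgebra.one_def]
  let F : HomogeneousLocalization.Away (weightedHomogeneousSubmodule k w) (monomial e 1) →+*
      MvPolynomial τ (AddMonoidAlgebra k M) :=
    (IsLocalization.Away.lift (S := Localization.Away (monomial e (1 : k))) _ hunit).comp
      (algebraMap _ _)
  have hF (n : ℕ) (x : MvPolynomial σ k) (hx) :
      F (.mk _ hf n x hx) * φ (monomial e 1) ^ n = φ x := by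
    let y : Submonoid.powers (monomial e (1 : k)) := ⟨monomial e 1 ^ n, n, rfl⟩
    have h : Localization.mk x y * algebraMap _ (Localization.Away (monomial e (1 : k))) y.1 =
        algebraMap _ _ x := by
      rw [Localization.mk_eq_mk', IsLocalization.mk'_spec]
    have h' := congrArg (IsLocalization.Away.lift _ hunit) h
    rwa [map_mul, IsLocalization.Away.lift_eq, IsLocalization.Away.lift_eq, map_pow] at h'
  refine ⟨RingEquiv.ofBijective F ⟨(injective_iff_map_eq_zero F).2 fun y hy ↦ ?_, ?_⟩⟩
  · obtain ⟨n, x, hx, rfl⟩ := HomogeneousLocalization.Away.mk_surjective _ hf y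
    have h := hF n x hx
    rw [hy, zero_mul] at h
    have hx0 : x = 0 := eq_zero_of_toGroupAlgebraPolynomial_eq_zero hinj hx h.symm
    exact HomogeneousLocalization.mk_eq_zero_of_num _ (Subtype.ext hx0)
  · rw [← RingHom.range_eq_top, eq_top_iff]
    rintro b -
    induction b using MvPolynomial.induction_on' with
    | add p q hp hq => exact add_mem hp hq
    | monomial t b =>
      induction b using AddMonoidAlgebra.induction_linear with
      | zero => simp
      | add p q hp hq => rw [map_add]; exact add_mem hp hq
      | single g r =>
        obtain ⟨N, a, haw, hau, hav⟩ := hsurj g t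
        have ha : monomial a r ∈ weightedHomogeneousSubmodule k w (N • Finsupp.weight w e) :=
          isWeightedHomogeneous_monomial w a r haw
        refine ⟨.mk _ hf N (monomial a r) ha,
          (hunit.pow N).mul_left_injective ((hF N _ ha).trans ?_)⟩
        simp only [φ, toGroupAlgebraPolynomial_monomial, monomial_pow, monomial_mul, he, hau, hav,
          AddMonoidAlgebra.single_pow, AddMonoidAlgebra.single_mul_single]
        simp

end MvPolynomial

end

theorem stmt_7 (k : Type) [Field k] [CharZero k] (n : ℕ) (hn : 1 ≤ n)
    (w : Fin (n + 1) → ℕ) (hw : ∀ i, 0 < w i)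
    (s : Finset (Fin (n + 1))) (hs : s.Nonempty)
    (hgcd : Finset.gcd s w = 1) (m : ℕ) (hm : m + 1 = s.card) :
    Nonempty
      (HomogeneousLocalization.Away (weightedHomogeneousSubmodule k w)
          (∏ i ∈ s, X i) ≃+*
        MvPolynomial (Fin (n - m)) (AddMonoidAlgebra k (Fin m → ℤ))) := by
  let W : (s → ℤ) →ₗ[ℤ] ℤ := Fintype.linearCombination ℤ fun i ↦ (w i : ℤ)
  have hW (z : s → ℤ) : W z = ∑ i, z i * (w i : ℤ) := rfl
  obtain ⟨c, hc⟩ := Finset.exists_sum_mul_eq_one_of_gcd_eq_one hgcd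
  obtain ⟨p, hp⟩ := LinearMap.exists_prod_bijective_of_surjective
    (hm.trans (Fintype.card_coe s).symm) W fun t ↦ ⟨t • c, by rw [map_smul, hW, hc, smul_eq_mul, mul_one]⟩
  let ε : {i // i ∉ s} ≃ Fin (n - m) := Fintype.equivFinOfCardEq (by
    rw [Fintype.card_subtype_compl, Fintype.card_fin, Fintype.card_coe]
    omega)
  let res : (Fin (n + 1) →₀ ℕ) →+ (s → ℤ) :=
    { toFun a i := a i
      map_zero' := by ext; simp
      map_add' a b := by ext; simp }
  let u : (Fin (n + 1) →₀ ℕ) →+ (Fin m → ℤ) := p.toAddMonoidHom.comp res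
  let v : (Fin (n + 1) →₀ ℕ) →+ (Fin (n - m) →₀ ℕ) :=
    (Finsupp.domCongr ε).toAddMonoidHom.comp Finsupp.subtypeDomainAddMonoidHom
  have hv (a) (i) (hi : i ∉ s) : v a (ε ⟨i, hi⟩) = a i := by
    simp [v, Finsupp.subtypeDomainAddMonoidHom]
  have hweight (a : Fin (n + 1) →₀ ℕ) :
      (Finsupp.weight w a : ℤ) = W (res a) + ∑ i, (v a i : ℤ) * w (ε.symm i) := by
    rw [Finsupp.weight_apply, Finsupp.sum_fintype _ _ (by simp), hW, ← ε.sum_comp]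
    simp only [hv, Equiv.symm_apply_apply]
    rw [← Fintype.sum_subtype_add_sum_subtype (· ∈ s)]
    push_cast
    congr 1
    exact Finset.sum_congr (by ext; simp) fun _ _ ↦ rfl
  let e : Fin (n + 1) →₀ ℕ := ∑ i ∈ s, Finsupp.single i 1
  have he (i) : e i = if i ∈ s then 1 else 0 := by
    simp [e, Finsupp.finsetSum_apply, Finsupp.single_apply]
  have hf : ∏ i ∈ s, X i = (monomial e 1 : MvPolynomial (Fin (n + 1)) k) := by
    rw [monomial_sum_one]
    rfl
  have hve : v e = 0 := by
    ext i
    obtain ⟨⟨i, hi⟩, rfl⟩ := ε.surjective i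
    rw [hv, he, if_neg hi, Finsupp.zero_apply]
  rw [hf]
  refine nonempty_away_monomial_ringEquiv (u := u) hve (fun a b hab hu hv' ↦ ?_) fun g t ↦ ?_
  · have hWab : W (res a) = W (res b) := by
      have h := hweight a
      rw [hab, hweight b, hv'] at h
      exact (add_right_cancel h).symm
    have hres : res a = res b := hp.1 (Prod.ext hu hWab)
    ext i
    by_cases hi : i ∈ s
    · exact Int.ofNat_inj.1 (congrFun hres ⟨i, hi⟩)
    · rw [← hv a i hi, ← hv b i hi, hv']
  · obtain ⟨z, hz⟩ := hp.2 (g, -∑ i, (t i : ℤ) * w (ε.symm i))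
    obtain ⟨hpz, hWz⟩ := Prod.ext_iff.1 hz
    let N : ℕ := ∑ i, (z i).natAbs
    let a : Fin (n + 1) →₀ ℕ := Finsupp.equivFunOnFinite.symm fun i ↦
      if hi : i ∈ s then (z ⟨i, hi⟩ + N).toNat else t (ε ⟨i, hi⟩)
    have hva : v a = t := by
      ext i
      obtain ⟨⟨i, hi⟩, rfl⟩ := ε.surjective i
      rw [hv]
      simp [a, hi]
    have hres : res a = z + N • res e := by
      ext i
      have hN : (z i).natAbs ≤ N := Finset.single_le_sum (f := fun i ↦ (z i).natAbs)
        (fun _ _ ↦ Nat.zero_le _) (Finset.mem_univ i)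
      have : 0 ≤ z i + N := by omega
      simp [res, a, he, this]
    refine ⟨N, a, ?_, ?_, hva⟩
    · zify
      rw [hweight, hva, hres, smul_eq_mul, Nat.cast_mul, hweight e, hve, map_add, map_nsmul]
      have : W z = -∑ i, (t i : ℤ) * w (ε.symm i) := hWz
      simp [this]
    · change p (res a) = g + N • p (res e)
      rw [hres, map_add, map_nsmul]
      exact congrArg (· + _) hpz
end

section
/- Let k be a field of characteristic zero, let n ≥ 1, let w : Fin (n+1) → ℕ with w i > 0 for all i, and let s be a nonempty subset (finset) of Fin (n+1) with Finset.gcd s w = 1; write m + 1 = s.card. Let f = ∏_{i ∈ s} X i, a weighted homogeneous element of MvPolynomial (Fin (n+1)) k. Then the open subscheme of Proj of the graded ring (MvPolynomial (Fin (n+1)) k graded by the weighted homogeneous submodules for w) determined by the basic open set D₊(f) is isomorphic, as a scheme, to Spec of MvPolynomial (Fin (n - m)) (AddMonoidAlgebra k (Fin m → ℤ)). -/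
open MvPolynomial AlgebraicGeometry

attribute [local instance] MvPolynomial.weightedGradedAlgebra

section WeightedProj

/-- A linear form on `ℤ^S` taking the value `1` is the first coordinate of some isomorphism
`ℤ^S ≃ ℤ × ℤ^m`. -/
theorem exists_linearEquiv_prod_fst_eq {S : Type*} [Fintype S] {m : ℕ}
    (hS : Fintype.card S = m + 1) (φ : (S → ℤ) →ₗ[ℤ] ℤ) (c : S → ℤ) (hc : φ c = 1) :
    ∃ E : (S → ℤ) ≃ₗ[ℤ] ℤ × (Fin m → ℤ), ∀ v, (E v).1 = φ v := by
  let π : (S → ℤ) →ₗ[ℤ] LinearMap.ker φ :=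
    (LinearMap.id - φ.smulRight c).codRestrict _ fun v ↦ by
      simp [hc, -zsmul_eq_mul]
  have hπ (v : S → ℤ) : (π v : S → ℤ) = v - φ v • c := rfl
  let E₀ : (S → ℤ) ≃ₗ[ℤ] ℤ × LinearMap.ker φ := .ofBijective (φ.prod π) <| by
    refine ⟨fun v v' h ↦ ?_, fun ⟨t, g⟩ ↦ ⟨g + t • c, ?_⟩⟩
    · obtain ⟨h₁, h₂⟩ := Prod.ext_iff.1 h
      replace h₂ := congrArg Subtype.val h₂
      simp only [LinearMap.prod_apply, Function.prod_apply] at h₁ h₂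
      rw [hπ, hπ, h₁] at h₂
      exact sub_left_injective h₂
    · have hφ : φ (g + t • c) = t := by simp [hc, -zsmul_eq_mul]
      refine Prod.ext hφ (Subtype.ext ?_)
      change (π _ : S → ℤ) = g
      rw [hπ, hφ, add_sub_cancel_right]
  have hrank : Module.finrank ℤ (LinearMap.ker φ) = Module.finrank ℤ (Fin m → ℤ) := by
    have := E₀.finrank_eq
    simp only [Module.finrank_prod, Module.finrank_pi, Module.finrank_self, hS] at this ⊢
    simp
    omega
  exact ⟨E₀.trans ((LinearEquiv.refl ℤ ℤ).prodCongr (LinearEquiv.ofFinrankEq _ _ hrank)),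
    fun v ↦ rfl⟩

variable {k σ P : Type*} [CommRing k] [AddCommMonoid P]

/-- The map `(k[σ]_f)₀ → k[P]` induced by a map of exponents `(σ →₀ ℕ) → P` which sends `f` to a
unit. -/
noncomputable def awayToAddMonoidAlgebra (w : σ → ℕ) (f : MvPolynomial σ k)
    (ν : (σ →₀ ℕ) →+ P) (hf : IsUnit (AddMonoidAlgebra.mapDomainRingHom k ν f)) :
    HomogeneousLocalization.Away (weightedHomogeneousSubmodule k w) f →+* AddMonoidAlgebra k P :=
  (IsLocalization.Away.lift (S := Localization.Away f) f hf).comp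
    (algebraMap (HomogeneousLocalization.Away (weightedHomogeneousSubmodule k w) f)
      (Localization.Away f))

theorem awayToAddMonoidAlgebra_mk_mul_pow {w : σ → ℕ} {f : MvPolynomial σ k} {ν : (σ →₀ ℕ) →+ P}
    (hf : IsUnit (AddMonoidAlgebra.mapDomainRingHom k ν f)) {d : ℕ}
    (hd : f ∈ weightedHomogeneousSubmodule k w d) (N : ℕ) (a : MvPolynomial σ k)
    (ha : a ∈ weightedHomogeneousSubmodule k w (N • d)) :
    awayToAddMonoidAlgebra w f ν hf (.mk _ hd N a ha) *
      AddMonoidAlgebra.mapDomainRingHom k ν f ^ N = AddMonoidAlgebra.mapDomainRingHom k ν a := by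
  rw [awayToAddMonoidAlgebra, RingHom.comp_apply, HomogeneousLocalization.algebraMap_apply,
    HomogeneousLocalization.Away.val_mk, ← map_pow,
    ← IsLocalization.Away.lift_eq (S := Localization.Away f) f hf (f ^ N), ← map_mul,
    ← IsLocalization.Away.lift_eq (S := Localization.Away f) f hf a]
  congr 1
  rw [← Localization.mk_one_eq_algebraMap, ← Localization.mk_one_eq_algebraMap,
    Localization.mk_mul, Localization.mk_eq_mk_iff, Localization.r_iff_exists]
  exact ⟨1, by simp [mul_comm]⟩

theorem mapDomainRingHom_injOn_weightedHomogeneousSubmodule {w : σ → ℕ} {ν : (σ →₀ ℕ) →+ P}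
    (hν : ∀ e e', Finsupp.weight w e = Finsupp.weight w e' → ν e = ν e' → e = e') (d : ℕ) :
    Set.InjOn (AddMonoidAlgebra.mapDomainRingHom k ν)
      (weightedHomogeneousSubmodule k w d : Set (MvPolynomial σ k)) := by
  intro a ha b hb hab
  have hinj : Set.InjOn ν {e | Finsupp.weight w e = d} :=
    fun e he e' he' h ↦ hν e e' (he.trans he'.symm) h
  refine AddMonoidAlgebra.coeff_injective
    (Finsupp.mapDomain_injOn _ hinj ?_ ?_ (congrArg AddMonoidAlgebra.coeff hab))
  · exact fun e he ↦ ha (Finsupp.mem_support_iff.1 he)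
  · exact fun e he ↦ hb (Finsupp.mem_support_iff.1 he)

/-- If a map of exponents is injective in each degree, and every element of `P` becomes the image
of an exponent of the appropriate degree after adding multiples of the exponent of the
monomial `f`, then it identifies `(k[σ]_f)₀` with `k[P]`. -/
theorem awayToAddMonoidAlgebra_bijective {w : σ → ℕ} {ν : (σ →₀ ℕ) →+ P} {e₀ : σ →₀ ℕ}
    (hf : IsUnit (AddMonoidAlgebra.mapDomainRingHom k ν (monomial e₀ 1)))
    (hinj : ∀ e e', Finsupp.weight w e = Finsupp.weight w e' → ν e = ν e' → e = e')
    (hsurj : ∀ p, ∃ (N : ℕ) (e : σ →₀ ℕ),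
      Finsupp.weight w e = N • Finsupp.weight w e₀ ∧ ν e = p + N • ν e₀) :
    Function.Bijective (awayToAddMonoidAlgebra w (monomial e₀ 1) ν hf) := by
  have hd : monomial e₀ (1 : k) ∈ weightedHomogeneousSubmodule k w (Finsupp.weight w e₀) :=
    isWeightedHomogeneous_monomial w e₀ 1 rfl
  have key := awayToAddMonoidAlgebra_mk_mul_pow hf hd
  constructor
  · rw [injective_iff_map_eq_zero]
    intro x hx
    obtain ⟨N, a, ha, rfl⟩ := HomogeneousLocalization.Away.mk_surjective _ hd x
    have h := key N a ha
    rw [hx, zero_mul] at h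
    have : a = 0 := mapDomainRingHom_injOn_weightedHomogeneousSubmodule hinj _ ha
      (zero_mem _) (h.symm.trans (map_zero _).symm)
    subst this
    ext
    simp [Localization.mk_zero]
  · intro y
    rw [← Set.mem_range, ← RingHom.coe_range, SetLike.mem_coe]
    induction y using AddMonoidAlgebra.induction_linear with
    | zero => exact zero_mem _
    | add x y hx hy => exact add_mem hx hy
    | single p r =>
      obtain ⟨N, e, he, hp⟩ := hsurj p
      have ha : monomial e r ∈ weightedHomogeneousSubmodule k w (N • Finsupp.weight w e₀) :=
        isWeightedHomogeneous_monomial w e r he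
      refine ⟨.mk _ hd N (monomial e r) ha, (hf.pow N).mul_left_injective ?_⟩
      beta_reduce
      rw [key, ← single_eq_monomial, ← single_eq_monomial]
      simp [hp, AddMonoidAlgebra.single_pow, AddMonoidAlgebra.single_mul_single]

/-- The exponents occurring in the dehomogenization of `k[σ]` with respect to the variables
in `s`, after a choice of coordinates `E` on `ℤ^s` and `emb` on the remaining variables. -/
noncomputable def dehomogenizeExponent {s : Finset σ} {τ ι : Type*} [Finite τ]
    (E : (s → ℤ) ≃ₗ[ℤ] ℤ × (ι → ℤ)) (emb : τ ≃ {i // i ∉ s}) :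
    (σ →₀ ℕ) →+ (τ →₀ ℕ) × (ι → ℤ) where
  toFun e := (Finsupp.equivFunOnFinite.symm fun t ↦ e (emb t), (E fun i ↦ (e i : ℤ)).2)
  map_zero' := by
    refine Prod.ext (by ext; simp) ?_
    change (E 0).2 = 0
    simp
  map_add' e e' := by
    refine Prod.ext (by ext; simp) ?_
    simpa [Pi.add_def] using
      congrArg Prod.snd (map_add E (fun i : s ↦ (e i : ℤ)) (fun i : s ↦ (e' i : ℤ)))

variable {s : Finset σ} {τ ι : Type*} [Fintype τ] {E : (s → ℤ) ≃ₗ[ℤ] ℤ × (ι → ℤ)}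
  {emb : τ ≃ {i // i ∉ s}}

theorem weight_eq_sum_add_sum [Fintype σ] (w : σ → ℕ) (emb : τ ≃ {i // i ∉ s}) (e : σ →₀ ℕ) :
    Finsupp.weight w e =
      ∑ i : s, w i * e i + ∑ t, w (emb t) * e (emb t) := by
  classical
  rw [Equiv.sum_comp emb (fun j ↦ w j * e j), Finsupp.weight_apply,
    Finsupp.sum_fintype _ _ (by simp), ← Fintype.sum_subtype_add_sum_subtype (· ∈ s)]
  simp only [smul_eq_mul, mul_comm]
  congr!

theorem dehomogenizeExponent_injOn [Fintype σ] {w : σ → ℕ}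
    (hE : ∀ v, (E v).1 = ∑ i : s, w i * v i) {e e' : σ →₀ ℕ}
    (hw : Finsupp.weight w e = Finsupp.weight w e')
    (h : dehomogenizeExponent E emb e = dehomogenizeExponent E emb e') : e = e' := by
  obtain ⟨h₁, h₂⟩ := Prod.ext_iff.1 h
  replace h₁ (t : τ) : e (emb t) = e' (emb t) := DFunLike.congr_fun h₁ t
  rw [weight_eq_sum_add_sum w emb, weight_eq_sum_add_sum w emb] at hw
  simp only [h₁, add_left_inj] at hw
  have h₃ : (fun i : s ↦ (e i : ℤ)) = fun i : s ↦ (e' i : ℤ) := by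
    refine E.injective (Prod.ext ?_ h₂)
    rw [hE, hE]
    exact_mod_cast hw
  ext i
  by_cases hi : i ∈ s
  · exact_mod_cast congrFun h₃ ⟨i, hi⟩
  · simpa using h₁ (emb.symm ⟨i, hi⟩)

theorem exists_dehomogenizeExponent_eq [Fintype σ] {w : σ → ℕ}
    (hE : ∀ v, (E v).1 = ∑ i : s, w i * v i) {e₀ : σ →₀ ℕ} (h₀ : ∀ i ∈ s, e₀ i = 1)
    (h₀' : ∀ i ∉ s, e₀ i = 0) (p : (τ →₀ ℕ) × (ι → ℤ)) :
    ∃ (N : ℕ) (e : σ →₀ ℕ), Finsupp.weight w e = N • Finsupp.weight w e₀ ∧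
      dehomogenizeExponent E emb e = p + N • dehomogenizeExponent E emb e₀ := by
  classical
  obtain ⟨y, g⟩ := p
  obtain ⟨v, hv⟩ := E.surjective (-∑ t, (w (emb t) * y t : ℤ), g)
  let N := ∑ i, (v i).natAbs
  have hN (i : s) : 0 ≤ v i + N := by
    have : (v i).natAbs ≤ N :=
      Finset.single_le_sum (f := fun i ↦ (v i).natAbs) (fun _ _ ↦ Nat.zero_le _) (Finset.mem_univ i)
    omega
  let e : σ →₀ ℕ := Finsupp.equivFunOnFinite.symm fun i ↦
    if hi : i ∈ s then (v ⟨i, hi⟩ + N).toNat else y (emb.symm ⟨i, hi⟩)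
  have he (i : s) : (e i : ℤ) = v i + N := by simp [e, hN]
  have hy (t : τ) : e (emb t) = y t := by simp [e, (emb t).2]
  have h₁ (t : τ) : e₀ (emb t) = 0 := h₀' _ (emb t).2
  have h₂ (i : s) : e₀ i = 1 := h₀ i i.2
  refine ⟨N, e, ?_, Prod.ext ?_ ?_⟩
  · have hφ := (hE v).symm.trans (congrArg Prod.fst hv)
    rw [weight_eq_sum_add_sum w emb, weight_eq_sum_add_sum w emb]
    zify
    simp only [he, hy, h₁, h₂, mul_add, Finset.sum_add_distrib, hφ, ← Finset.sum_mul]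
    simp [mul_comm]
  · ext t
    simp [dehomogenizeExponent, hy, h₁]
  · have : (fun i : s ↦ (e i : ℤ)) = v + N • fun i : s ↦ (e₀ i : ℤ) := by
      ext i
      simp [he, h₂]
    simp [dehomogenizeExponent, this, hv, -nsmul_eq_mul]

theorem isUnit_mapDomainRingHom_dehomogenizeExponent {e₀ : σ →₀ ℕ} (h₀ : ∀ i ∉ s, e₀ i = 0) :
    IsUnit (AddMonoidAlgebra.mapDomainRingHom k (dehomogenizeExponent E emb)
      (monomial e₀ (1 : k))) := by
  rw [← single_eq_monomial, AddMonoidAlgebra.mapDomainRingHom_apply,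
    AddMonoidAlgebra.mapDomain_single]
  have h (t : τ) : e₀ (emb t) = 0 := h₀ _ (emb t).2
  set p := dehomogenizeExponent E emb e₀
  have hp : p.1 = 0 := by
    ext t
    simp [p, dehomogenizeExponent, h]
  refine IsUnit.of_mul_eq_one (AddMonoidAlgebra.single (0, -p.2) 1) ?_
  rw [AddMonoidAlgebra.single_mul_single, AddMonoidAlgebra.one_def, mul_one]
  congr 1
  exact Prod.ext (by simp [hp]) (by simp)

end WeightedProj

theorem stmt_8 (k : Type) [Field k] [CharZero k] (n : ℕ) (hn : 1 ≤ n)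
    (w : Fin (n + 1) → ℕ) (hw : ∀ i, 0 < w i)
    (s : Finset (Fin (n + 1))) (hs : s.Nonempty)
    (hgcd : Finset.gcd s w = 1) (m : ℕ) (hm : m + 1 = s.card) :
    Nonempty
      ((Scheme.Opens.toScheme
          (X := Proj (weightedHomogeneousSubmodule k w))
          (ProjectiveSpectrum.basicOpen (weightedHomogeneousSubmodule k w)
            (∏ i ∈ s, X i))) ≅
        Spec (CommRingCat.of
          (MvPolynomial (Fin (n - m)) (AddMonoidAlgebra k (Fin m → ℤ))))) := by
  classical
  let φ : (s → ℤ) →ₗ[ℤ] ℤ := Fintype.linearCombination ℤ fun i : s ↦ (w i : ℤ)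
  have hφ (v : s → ℤ) : φ v = ∑ i : s, w i * v i := by
    simp [φ, Fintype.linearCombination_apply, mul_comm]
  obtain ⟨c, hc⟩ : ∃ c : s → ℤ, φ c = 1 := by
    obtain ⟨c, hc⟩ := Finset.gcd_eq_sum_mul s (fun i ↦ (w i : ℤ))
    have hgcd' : s.gcd (fun i ↦ (w i : ℤ)) = 1 := by
      rw [← Finset.normalize_gcd, normalize_eq_one, Int.isUnit_iff_natAbs_eq, ← Nat.dvd_one]
      refine (Finset.dvd_gcd fun i hi ↦ Int.natCast_dvd_natCast.1 (by
        simpa using Finset.gcd_dvd (f := fun i ↦ (w i : ℤ)) hi)).trans hgcd.dvd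
    refine ⟨fun i ↦ c i, ?_⟩
    rw [hφ, ← hgcd', hc, ← Finset.sum_coe_sort s]
  obtain ⟨E, hE⟩ := exists_linearEquiv_prod_fst_eq (m := m) (by simp [hm]) φ c hc
  replace hE v := (hE v).trans (hφ v)
  let emb : Fin (n - m) ≃ {i // i ∉ s} := Fintype.equivOfCardEq <| by
    rw [Fintype.card_subtype_compl]
    simp [← hm]
  let e₀ : Fin (n + 1) →₀ ℕ := ∑ i ∈ s, Finsupp.single i 1
  have he₀ (i) : e₀ i = if i ∈ s then 1 else 0 := by
    simp [e₀, Finsupp.finsetSum_apply, Finsupp.single_apply]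
  have h₀ : ∀ i ∈ s, e₀ i = 1 := fun i hi ↦ by simp [he₀, hi]
  have h₀' : ∀ i ∉ s, e₀ i = 0 := fun i hi ↦ by simp [he₀, hi]
  have hf : (∏ i ∈ s, X i : MvPolynomial (Fin (n + 1)) k) = monomial e₀ 1 := by
    simp [e₀, monomial_sum_one, X]
  have hpos : 0 < Finsupp.weight w e₀ := by
    obtain ⟨i, hi⟩ := hs
    exact Nat.lt_of_lt_of_le (by simp [h₀ i hi]) (Finsupp.le_weight w (hw i).ne' e₀)
  rw [hf]
  have e : HomogeneousLocalization.Away (weightedHomogeneousSubmodule k w) (monomial e₀ 1) ≃+*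
      MvPolynomial (Fin (n - m)) (AddMonoidAlgebra k (Fin m → ℤ)) :=
    (RingEquiv.ofBijective _ (awayToAddMonoidAlgebra_bijective
      (isUnit_mapDomainRingHom_dehomogenizeExponent (E := E) (emb := emb) h₀')
      (fun _ _ ↦ dehomogenizeExponent_injOn hE)
      (exists_dehomogenizeExponent_eq hE h₀ h₀'))).trans AddMonoidAlgebra.curryRingEquiv
  exact ⟨Proj.basicOpenIsoSpec _ _ (isWeightedHomogeneous_monomial w e₀ (1 : k) rfl) hpos ≪≫
    Scheme.Spec.mapIso e.symm.toCommRingCatIso.op⟩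
end

section
/- Let k be a field of characteristic zero, let n ≥ 1, let w : Fin (n+1) → ℕ with w i > 0 for all i, and suppose w m = 1 for some index m. Then HomogeneousLocalization.Away (MvPolynomial.weightedHomogeneousSubmodule k w) (X m) is isomorphic as a ring to MvPolynomial (Fin n) k; that is, the basic open set D₊(x_m) of the weighted projective space ℙ(w) is isomorphic to affine n-space over k. -/
open MvPolynomial AlgebraicGeometry

attribute [local instance] MvPolynomial.weightedGradedAlgebra

namespace MvPolynomial

section General

variable {R S σ : Type*} [CommRing R] [CommRing S] [Algebra R S]

lemma IsWeightedHomogeneous.aeval_mul_pow {w : σ → ℕ} {D : ℕ} {p : MvPolynomial σ R}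
    (hp : p.IsWeightedHomogeneous w D) (a : σ → S) (u : S) :
    aeval (fun i ↦ a i * u ^ w i) p = aeval a p * u ^ D := by
  induction hp using IsWeightedHomogeneous.induction_on with
  | zero => simp
  | add p q _ _ hp hq => simp only [map_add, hp, hq, add_mul]
  | monomial d r hd =>
    rw [aeval_monomial, aeval_monomial, mul_assoc, ← hd, Finsupp.weight_apply, Finsupp.sum,
      ← Finset.prod_pow_eq_pow_sum, Finsupp.prod, Finsupp.prod, ← Finset.prod_mul_distrib]
    simp only [mul_pow, ← pow_mul, smul_eq_mul, mul_comm]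

end General

section Dehomogenize

variable (R : Type*) [CommRing R] {n : ℕ}

/-- The dehomogenization map, setting the variable `X m` to `1`. -/
noncomputable def dehomogenize (m : Fin (n + 1)) :
    MvPolynomial (Fin (n + 1)) R →ₐ[R] MvPolynomial (Fin n) R :=
  aeval (m.insertNth 1 X)

@[simp]
lemma dehomogenize_X_self (m : Fin (n + 1)) : dehomogenize R m (X m) = 1 := by
  simp [dehomogenize]

@[simp]
lemma dehomogenize_X_succAbove (m : Fin (n + 1)) (j : Fin n) :
    dehomogenize R m (X (m.succAbove j)) = X j := by
  simp [dehomogenize]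

variable {R}

/-- A weighted homogeneous polynomial killed by dehomogenization at a variable of weight one
vanishes wherever that variable is invertible. -/
lemma IsWeightedHomogeneous.aeval_eq_zero_of_dehomogenize_eq_zero {S : Type*} [CommRing S]
    [Algebra R S] {w : Fin (n + 1) → ℕ} {m : Fin (n + 1)} (hm : w m = 1) {D : ℕ}
    {p : MvPolynomial (Fin (n + 1)) R} (hp : p.IsWeightedHomogeneous w D)
    (h : dehomogenize R m p = 0) (a : Fin (n + 1) → S) (ha : IsUnit (a m)) :
    aeval a p = 0 := by
  obtain ⟨u, hu⟩ := ha.exists_right_inv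
  have hcomp : aeval (fun i ↦ a i * u ^ w i) =
      (aeval fun j ↦ a (m.succAbove j) * u ^ w (m.succAbove j)).comp (dehomogenize R m) := by
    ext i
    cases i using m.succAboveCases <;> simp [hm, hu]
  have hpu : aeval a p * u ^ D = 0 := by
    rw [← hp.aeval_mul_pow, hcomp, AlgHom.comp_apply, h, map_zero]
  have hu' : IsUnit u := IsUnit.of_mul_eq_one _ ((mul_comm _ _).trans hu)
  exact (hu'.pow D).mul_left_eq_zero.mp hpu

/-- The map from the degree-zero part of the localization away from `X m` to the polynomial ring
in the remaining variables, induced by dehomogenization. -/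
noncomputable def awayDehomogenize (w : Fin (n + 1) → ℕ) (m : Fin (n + 1)) :
    HomogeneousLocalization.Away (weightedHomogeneousSubmodule R w) (X m) →+*
      MvPolynomial (Fin n) R :=
  (Localization.awayLift (dehomogenize R m).toRingHom (X m)
    (isUnit_iff_exists_inv.mpr ⟨1, by simp⟩)).comp (algebraMap _ _)

lemma X_mem_weightedHomogeneousSubmodule (w : Fin (n + 1) → ℕ) (i : Fin (n + 1)) :
    (X i : MvPolynomial (Fin (n + 1)) R) ∈ weightedHomogeneousSubmodule R w (w i) :=
  isWeightedHomogeneous_X R w i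

lemma awayDehomogenize_mk (w : Fin (n + 1) → ℕ) (m : Fin (n + 1)) (N : ℕ)
    (p : MvPolynomial (Fin (n + 1)) R) (hp : p ∈ weightedHomogeneousSubmodule R w (N • w m)) :
    awayDehomogenize w m (HomogeneousLocalization.Away.mk _
      (X_mem_weightedHomogeneousSubmodule w m) N p hp) = dehomogenize R m p := by
  have h := Localization.awayLift_mk (dehomogenize R m).toRingHom (X m) p 1 (by simp) N
  exact h.trans (by simp)

lemma awayDehomogenize_injective {w : Fin (n + 1) → ℕ} {m : Fin (n + 1)} (hm : w m = 1) :
    Function.Injective (awayDehomogenize (R := R) w m) := by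
  rw [injective_iff_map_eq_zero]
  intro x hx
  obtain ⟨N, p, hp, rfl⟩ := HomogeneousLocalization.Away.mk_surjective _
    (X_mem_weightedHomogeneousSubmodule w m) x
  rw [awayDehomogenize_mk] at hx
  have hX := hp.aeval_eq_zero_of_dehomogenize_eq_zero hm hx
    (algebraMap (MvPolynomial (Fin (n + 1)) R)
      (Localization.Away (X m : MvPolynomial (Fin (n + 1)) R)) ∘ X)
    (IsLocalization.Away.algebraMap_isUnit _)
  rw [aeval_algebraMap_apply, aeval_X_left_apply] at hX
  apply HomogeneousLocalization.val_injective
  rw [HomogeneousLocalization.Away.val_mk, HomogeneousLocalization.val_zero,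
    Localization.mk_eq_mk', IsLocalization.mk'_eq_mul_mk'_one, hX, zero_mul]

lemma awayDehomogenize_surjective {w : Fin (n + 1) → ℕ} {m : Fin (n + 1)} (hm : w m = 1) :
    Function.Surjective (awayDehomogenize (R := R) w m) := by
  intro q
  induction q using MvPolynomial.induction_on with
  | C c =>
    refine ⟨_, (awayDehomogenize_mk w m 0 (C c) ?_).trans (algHom_C _ c)⟩
    rw [zero_smul]
    exact isWeightedHomogeneous_C w c
  | add p q hp hq =>
    obtain ⟨x, rfl⟩ := hp
    obtain ⟨y, rfl⟩ := hq
    exact ⟨x + y, map_add _ x y⟩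
  | mul_X p j hp =>
    obtain ⟨x, rfl⟩ := hp
    have hj : X (m.succAbove j) ∈ weightedHomogeneousSubmodule R w (w (m.succAbove j) • w m) := by
      rw [hm, smul_eq_mul, mul_one]
      exact X_mem_weightedHomogeneousSubmodule w _
    refine ⟨x * HomogeneousLocalization.Away.mk _
      (X_mem_weightedHomogeneousSubmodule w m) _ _ hj, ?_⟩
    rw [map_mul, awayDehomogenize_mk, dehomogenize_X_succAbove]

end Dehomogenize

end MvPolynomial

theorem stmt_9 (k : Type) [Field k] [CharZero k] (n : ℕ) (hn : 1 ≤ n)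
    (w : Fin (n + 1) → ℕ) (hw : ∀ i, 0 < w i) (m : Fin (n + 1)) (hm : w m = 1) :
    Nonempty
      (HomogeneousLocalization.Away (weightedHomogeneousSubmodule k w) (X m) ≃+*
        MvPolynomial (Fin n) k) :=
  ⟨RingEquiv.ofBijective (awayDehomogenize w m)
    ⟨awayDehomogenize_injective hm, awayDehomogenize_surjective hm⟩⟩
end

section
/- Let k be a field of characteristic zero, let n ≥ 1, let w : Fin (n+1) → ℕ with w i > 0 for all i, and let i be any index. Then there exist a commutative k-algebra R, a nonempty open subscheme U of Proj of the graded ring (MvPolynomial (Fin (n+1)) k graded by the weighted homogeneous submodules for w) with underlying open set contained in the basic open set D₊(X i), and an isomorphism of schemes between U and Spec (Polynomial R). In particular, every basic open set D₊(x_i) of a weighted projective space, and hence the weighted projective space itself, contains a cylinder. -/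
open MvPolynomial AlgebraicGeometry

attribute [local instance] MvPolynomial.weightedGradedAlgebra

/-- A half-space of a lattice splits off a free direct summand `ℕ`: if some `g ∈ L` has
`0 < π g`, then `{g ∈ L | 0 ≤ π g}` is isomorphic to `ℕ × {g ∈ L | π g = 0}`. -/
theorem AddSubgroup.nonempty_halfSpace_addEquiv {G : Type*} [AddCommGroup G] (L : AddSubgroup G)
    (π : G →+ ℤ) (h : ∃ g ∈ L, 0 < π g) :
    Nonempty (ℕ × (L ⊓ π.ker : AddSubgroup G) ≃+
      (L.toAddSubmonoid ⊓ (AddSubmonoid.nonneg ℤ).comap π : AddSubmonoid G)) := by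
  classical
  have hex : ∃ e : ℕ, 0 < e ∧ ∃ g ∈ L, π g = e := by
    obtain ⟨g, hg, hpos⟩ := h
    exact ⟨(π g).toNat, by omega, g, hg, by omega⟩
  obtain ⟨he, g₀, hg₀, hπ⟩ := Nat.find_spec hex
  have hmin : ∀ m : ℕ, 0 < m → (∃ g ∈ L, π g = m) → Nat.find hex ≤ m :=
    fun m hm hg ↦ Nat.find_min' hex ⟨hm, hg⟩
  generalize Nat.find hex = e at he hπ hmin
  let F : ℕ × (L ⊓ π.ker : AddSubgroup G) →+
      (L.toAddSubmonoid ⊓ (AddSubmonoid.nonneg ℤ).comap π : AddSubmonoid G) :=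
    { toFun := fun p ↦ ⟨p.1 • g₀ + p.2, by
        have h₂ := p.2.2
        simp only [AddSubgroup.mem_inf, AddMonoidHom.mem_ker] at h₂
        refine AddSubmonoid.mem_inf.2 ⟨L.add_mem (L.nsmul_mem hg₀ _) h₂.1, ?_⟩
        simp only [AddSubmonoid.mem_comap, AddSubmonoid.mem_nonneg, map_add, map_nsmul, h₂.2, hπ]
        positivity⟩
      map_zero' := by ext; simp
      map_add' := fun p q ↦ by ext; simp [add_smul]; abel }
  refine ⟨AddEquiv.ofBijective F ⟨?_, ?_⟩⟩
  · rintro ⟨a, x, hx⟩ ⟨b, y, hy⟩ hab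
    have hab' : a • g₀ + x = b • g₀ + y := congrArg Subtype.val hab
    simp only [AddSubgroup.mem_inf, AddMonoidHom.mem_ker] at hx hy
    have hπab := congrArg π hab'
    simp only [map_add, map_nsmul, hx.2, hy.2, hπ, add_zero, nsmul_eq_mul] at hπab
    obtain rfl : a = b := by
      exact_mod_cast mul_right_cancel₀ (by exact_mod_cast he.ne' : (e : ℤ) ≠ 0) hπab
    obtain rfl : x = y := add_left_cancel hab'
    rfl
  · rintro ⟨g, hg⟩
    have hgL : g ∈ L := hg.1
    have hgπ : 0 ≤ π g := hg.2
    obtain ⟨m, hm⟩ := Int.eq_ofNat_of_zero_le hgπ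
    have hsub : π (g - (m / e) • g₀) = (m % e : ℕ) := by
      rw [map_sub, map_nsmul, hπ, hm, nsmul_eq_mul]
      have : ((m / e * e + m % e : ℕ) : ℤ) = m := by rw [Nat.div_add_mod']
      rw [Nat.cast_add, Nat.cast_mul] at this
      omega
    have hmem : g - (m / e) • g₀ ∈ L := L.sub_mem hgL (L.nsmul_mem hg₀ _)
    have hmod : m % e = 0 := by
      by_contra hne
      exact (hmin _ (Nat.pos_of_ne_zero hne) ⟨_, hmem, hsub⟩).not_gt (Nat.mod_lt _ he)
    rw [hmod, Nat.cast_zero] at hsub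
    exact ⟨(m / e, ⟨g - (m / e) • g₀, hmem, hsub⟩), Subtype.ext (by simp [F])⟩

namespace MvPolynomial

variable {σ : Type*} (k : Type*) [Field k]

/-- The inclusion of the exponents of monomials into those of Laurent monomials. -/
noncomputable def intExponent : (σ →₀ ℕ) →+ (σ →₀ ℤ) :=
  Finsupp.mapRange.addMonoidHom (Nat.castAddMonoidHom ℤ)

@[simp]
theorem intExponent_apply (s : σ →₀ ℕ) (l : σ) : intExponent s l = s l := rfl

theorem intExponent_injective : Function.Injective (intExponent (σ := σ)) := fun s t h ↦ by
  ext l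
  simpa using DFunLike.congr_fun h l

theorem weight_intExponent (w : σ → ℕ) (s : σ →₀ ℕ) :
    Finsupp.weight (fun l ↦ (w l : ℤ)) (intExponent s) = Finsupp.weight w s := by
  induction s using Finsupp.induction_linear with
  | zero => simp
  | add s t hs ht => simp [hs, ht]
  | single l a => simp [intExponent, Finsupp.weight_single]

/-- The inclusion of the polynomial ring into the ring of Laurent polynomials. -/
noncomputable def toLaurent : MvPolynomial σ k →+* AddMonoidAlgebra k (σ →₀ ℤ) :=
  AddMonoidAlgebra.mapDomainRingHom k intExponent

theorem toLaurent_monomial (s : σ →₀ ℕ) (c : k) :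
    toLaurent k (monomial s c) = AddMonoidAlgebra.single (intExponent s) c :=
  AddMonoidAlgebra.mapDomain_single

theorem toLaurent_injective : Function.Injective (toLaurent (σ := σ) k) :=
  AddMonoidAlgebra.mapDomain_injective intExponent_injective

theorem isUnit_toLaurent_monomial (v : σ →₀ ℕ) : IsUnit (toLaurent k (monomial v 1)) := by
  refine IsUnit.of_mul_eq_one (AddMonoidAlgebra.single (-intExponent v) 1) ?_
  rw [toLaurent_monomial, AddMonoidAlgebra.single_mul_single, add_neg_cancel, one_mul,
    AddMonoidAlgebra.one_def]

/-- The exponents of the Laurent monomials of weight zero whose denominators involve only the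
variables occurring in `v`. -/
noncomputable def awayExponents (w : σ → ℕ) (v : σ →₀ ℕ) : AddSubmonoid (σ →₀ ℤ) where
  carrier := {g | Finsupp.weight (fun l ↦ (w l : ℤ)) g = 0 ∧ ∀ l, v l = 0 → 0 ≤ g l}
  zero_mem' := by simp
  add_mem' := fun ha hb ↦ ⟨by rw [map_add, ha.1, hb.1, add_zero],
    fun l hl ↦ add_nonneg (ha.2 l hl) (hb.2 l hl)⟩

/-- The degree zero part of the localization at a monomial, as a ring of Laurent polynomials. -/
noncomputable def awayToLaurent (w : σ → ℕ) (v : σ →₀ ℕ) :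
    HomogeneousLocalization.Away (weightedHomogeneousSubmodule k w) (monomial v (1 : k)) →+*
      AddMonoidAlgebra k (σ →₀ ℤ) :=
  (IsLocalization.Away.lift (S := Localization.Away (monomial v (1 : k))) (monomial v (1 : k))
    (isUnit_toLaurent_monomial k v)).comp (algebraMap _ _)

theorem awayToLaurent_injective (w : σ → ℕ) (v : σ →₀ ℕ) :
    Function.Injective (awayToLaurent k w v) := by
  have hreg : Submonoid.powers (monomial v (1 : k)) ≤ nonZeroDivisors _ :=
    powers_le_nonZeroDivisors_of_noZeroDivisors (by simp)
  rw [awayToLaurent, RingHom.coe_comp]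
  refine Function.Injective.comp ?_ (HomogeneousLocalization.val_injective _)
  refine (IsLocalization.lift_injective_iff _).2 fun x y ↦ ?_
  rw [(IsLocalization.injective _ hreg).eq_iff, (toLaurent_injective k).eq_iff]

theorem weightedHomogeneous_monomial_mem (w : σ → ℕ) (v : σ →₀ ℕ) :
    monomial v (1 : k) ∈ weightedHomogeneousSubmodule k w (Finsupp.weight w v) :=
  isWeightedHomogeneous_monomial _ _ _ rfl

theorem awayToLaurent_mk (w : σ → ℕ) (v : σ →₀ ℕ) (N : ℕ) (a : MvPolynomial σ k)
    (ha : a ∈ weightedHomogeneousSubmodule k w (N • Finsupp.weight w v)) :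
    awayToLaurent k w v (HomogeneousLocalization.Away.mk _
      (weightedHomogeneous_monomial_mem k w v) N a ha) =
      toLaurent k a * AddMonoidAlgebra.single (-(N • intExponent v)) 1 := by
  rw [awayToLaurent, RingHom.comp_apply, HomogeneousLocalization.algebraMap_apply,
    HomogeneousLocalization.Away.val_mk, Localization.mk_eq_mk', IsLocalization.Away.lift,
    IsLocalization.lift_mk'_spec]
  simp only [monomial_pow, one_pow]
  rw [toLaurent_monomial, mul_left_comm,
    AddMonoidAlgebra.single_mul_single, map_nsmul, add_neg_cancel, one_mul,
    ← AddMonoidAlgebra.one_def, mul_one]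

theorem range_awayToLaurent (w : σ → ℕ) (v : σ →₀ ℕ) :
    (awayToLaurent k w v).range =
      (AddMonoidAlgebra.mapDomainRingHom k (awayExponents w v).subtype).range := by
  apply le_antisymm
  · rintro _ ⟨z, rfl⟩
    obtain ⟨N, a, ha, rfl⟩ := HomogeneousLocalization.Away.mk_surjective _
      (weightedHomogeneous_monomial_mem k w v) z
    rw [awayToLaurent_mk, a.as_sum, map_sum, Finset.sum_mul]
    refine Subring.sum_mem _ fun s hs ↦ ?_
    rw [toLaurent_monomial, AddMonoidAlgebra.single_mul_single, mul_one]
    refine ⟨AddMonoidAlgebra.single ⟨intExponent s + -(N • intExponent v), ?_, fun l hl ↦ ?_⟩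
      (coeff s a), AddMonoidAlgebra.mapDomain_single⟩
    · have hweight := ha (mem_support_iff.1 hs)
      rw [map_add, map_neg, map_nsmul, weight_intExponent, weight_intExponent, hweight]
      simp
    · simp [hl]
  · rintro _ ⟨x, rfl⟩
    induction x using AddMonoidAlgebra.induction_linear with
    | zero => rw [map_zero]; exact Subring.zero_mem _
    | add x y hx hy => rw [map_add]; exact Subring.add_mem _ hx hy
    | single g c =>
      obtain ⟨g, hg, hpos⟩ := g
      let N := ∑ l ∈ g.support, (g l).natAbs
      let s : σ →₀ ℕ := (g + N • intExponent v).mapRange Int.toNat rfl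
      have hs : intExponent s = g + N • intExponent v := by
        ext l
        suffices 0 ≤ g l + N * v l by simpa [s] using this
        by_cases hv : v l = 0
        · simpa [hv] using hpos l hv
        · have hle : (g l).natAbs ≤ N := by
            by_cases hl : l ∈ g.support
            · exact Finset.single_le_sum (f := fun l ↦ (g l).natAbs)
                (fun _ _ ↦ Nat.zero_le _) hl
            · simp [Finsupp.notMem_support_iff.1 hl]
          have : N ≤ N * v l := Nat.le_mul_of_pos_right _ (Nat.pos_of_ne_zero hv)
          have : (N : ℤ) ≤ N * v l := by exact_mod_cast this
          omega
      have hsw : monomial s c ∈ weightedHomogeneousSubmodule k w (N • Finsupp.weight w v) := by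
        refine isWeightedHomogeneous_monomial _ _ _ ?_
        have := weight_intExponent w s
        rw [hs, map_add, hg, map_nsmul, weight_intExponent, zero_add, nsmul_eq_mul] at this
        rw [smul_eq_mul]
        exact_mod_cast this.symm
      refine ⟨HomogeneousLocalization.Away.mk _ (weightedHomogeneous_monomial_mem k w v) N
        (monomial s c) hsw, ?_⟩
      rw [awayToLaurent_mk, toLaurent_monomial, AddMonoidAlgebra.single_mul_single, hs, mul_one,
        add_neg_cancel_right]
      simp

/-- The degree zero part of the localization at a monomial is a monoid algebra. -/
noncomputable def awayEquiv (w : σ → ℕ) (v : σ →₀ ℕ) :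
    HomogeneousLocalization.Away (weightedHomogeneousSubmodule k w) (monomial v (1 : k)) ≃+*
      AddMonoidAlgebra k (awayExponents w v) :=
  (RingEquiv.ofLeftInverse (Function.leftInverse_invFun (awayToLaurent_injective k w v))).trans <|
    (RingEquiv.subringCongr (range_awayToLaurent k w v)).trans
      (RingEquiv.ofLeftInverse (f := AddMonoidAlgebra.mapDomainRingHom k (awayExponents w v).subtype)
        (Function.leftInverse_invFun
          (AddMonoidAlgebra.mapDomain_injective Subtype.val_injective))).symm

/-- Inverting all variables but one gives a polynomial ring in degree zero. -/
theorem exists_away_ringEquiv_polynomial (w : σ → ℕ) (v : σ →₀ ℕ) {i j : σ} (hij : i ≠ j)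
    (hi : 0 < w i) (hv : ∀ l, v l = 0 ↔ l = j) :
    ∃ K : AddSubgroup (σ →₀ ℤ), Nonempty
      (HomogeneousLocalization.Away (weightedHomogeneousSubmodule k w) (monomial v (1 : k)) ≃+*
        Polynomial (AddMonoidAlgebra k K)) := by
  let L : AddSubgroup (σ →₀ ℤ) :=
    (Finsupp.weight (R := ℤ) (fun l ↦ (w l : ℤ)) : (σ →₀ ℤ) →+ ℤ).ker
  let π : (σ →₀ ℤ) →+ ℤ := Finsupp.applyAddHom j
  have hM : awayExponents w v = L.toAddSubmonoid ⊓ (AddSubmonoid.nonneg ℤ).comap π := by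
    ext g
    simp [awayExponents, L, π, hv]
  obtain ⟨e⟩ := L.nonempty_halfSpace_addEquiv π
    ⟨Finsupp.single j (w i : ℤ) - Finsupp.single i (w j : ℤ), by
      simp [L, AddMonoidHom.mem_ker, Finsupp.weight_single, mul_comm], by
      simpa [π, hij] using hi⟩
  rw [← hM] at e
  exact ⟨_, ⟨(awayEquiv k w v).trans <|
    (AddMonoidAlgebra.mapDomainRingEquiv k e.symm).trans <|
    AddMonoidAlgebra.curryRingEquiv.trans (Polynomial.toFinsuppIso _).symm⟩⟩

end MvPolynomial

theorem stmt_10 (k : Type) [Field k] [CharZero k] (n : ℕ) (hn : 1 ≤ n)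
    (w : Fin (n + 1) → ℕ) (hw : ∀ i, 0 < w i) (i : Fin (n + 1)) :
    ∃ (R : Type) (_ : CommRing R) (_ : Algebra k R)
      (U : (Proj (weightedHomogeneousSubmodule k w)).Opens),
      (U : Set (Proj (weightedHomogeneousSubmodule k w))).Nonempty ∧
      (U : Set (Proj (weightedHomogeneousSubmodule k w))) ⊆
        (ProjectiveSpectrum.basicOpen (weightedHomogeneousSubmodule k w)
          (X i) : Set (ProjectiveSpectrum (weightedHomogeneousSubmodule k w))) ∧
      Nonempty (U.toScheme ≅ Spec (CommRingCat.of (Polynomial R))) := by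
  have : Nontrivial (Fin (n + 1)) := Fin.nontrivial_iff_two_le.2 (by omega)
  obtain ⟨j, hj⟩ := exists_ne i
  let v : Fin (n + 1) →₀ ℕ := Finsupp.equivFunOnFinite.symm fun l ↦ if l = j then 0 else 1
  have hvi : v i = 1 := by simp [v, hj.symm]
  obtain ⟨K, ⟨e⟩⟩ := exists_away_ringEquiv_polynomial k w v hj.symm (hw i) (by simp [v])
  have hdeg : 0 < Finsupp.weight w v := by
    have := Finsupp.le_weight_of_ne_zero' w (f := v) (s := i) (by simp [hvi])
    exact (hw i).trans_le this
  have iso := (Proj.basicOpenIsoSpec _ _ (weightedHomogeneous_monomial_mem k w v) hdeg).trans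
    (Scheme.Spec.mapIso e.symm.toCommRingCatIso.op)
  refine ⟨AddMonoidAlgebra k K, inferInstance, inferInstance,
    Proj.basicOpen (weightedHomogeneousSubmodule k w) (monomial v 1), ?_, ?_, ⟨iso⟩⟩
  · obtain ⟨x⟩ : Nonempty (Spec (CommRingCat.of (Polynomial (AddMonoidAlgebra k K)))) :=
      inferInstanceAs (Nonempty (PrimeSpectrum _))
    exact ⟨_, (iso.inv x).2⟩
  · exact Proj.basicOpen_mono _ _ _ (X_dvd_monomial.2 (Or.inr (by simp [hvi])))
end

section
/- Let k be a field of characteristic zero, let m ≥ 0, and let b : Fin (m+1) → ℤ be such that the greatest common divisor of the integers b 0, …, b m is 1. In the group algebra AddMonoidAlgebra k (Fin (m+1) → ℤ) (the Laurent polynomial ring in m+1 variables over k), consider the element u = AddMonoidAlgebra.single b 1 (the Laurent monomial Y_0^{b_0}⋯Y_m^{b_m}). Then the quotient ring AddMonoidAlgebra k (Fin (m+1) → ℤ) ⧸ Ideal.span {u − 1} is isomorphic as a ring to AddMonoidAlgebra k (Fin m → ℤ), the Laurent polynomial ring in m variables over k. -/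
/-- Bézout's identity for a finite family of integers. -/
theorem exists_sum_mul_eq_one_of_gcd_natAbs_eq_one {ι : Type*} [Fintype ι] (b : ι → ℤ)
    (hgcd : Finset.gcd Finset.univ (fun i => (b i).natAbs) = 1) :
    ∃ c : ι → ℤ, ∑ i, c i * b i = 1 := by
  rw [← Ideal.mem_span_range_iff_exists_fun, ← Ideal.eq_top_iff_one]
  obtain ⟨d, hd⟩ := (IsPrincipalIdealRing.principal (Ideal.span (Set.range b))).principal
  rw [hd]
  refine Ideal.span_singleton_eq_top.2 (Int.isUnit_iff_natAbs_eq.2 (Nat.dvd_one.1 ?_))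
  rw [← hgcd]
  refine Finset.dvd_gcd fun i _ => Int.natAbs_dvd_natAbs.2 (Ideal.mem_span_singleton.1 ?_)
  exact hd.le (Ideal.subset_span (Set.mem_range_self i))

/-- A vector of `ℤ^(m+1)` on which some integral functional `φ` takes the value `1` spans a direct
summand with complement isomorphic to `ℤ^m`. -/
theorem exists_projection_along {m : ℕ} (φ : (Fin (m + 1) → ℤ) →ₗ[ℤ] ℤ) (b : Fin (m + 1) → ℤ)
    (hφ : φ b = 1) :
    ∃ (p : (Fin (m + 1) → ℤ) →ₗ[ℤ] (Fin m → ℤ)) (s : (Fin m → ℤ) →ₗ[ℤ] (Fin (m + 1) → ℤ)),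
      p b = 0 ∧ (∀ w, p (s w) = w) ∧ ∀ v, v = s (p v) + φ v • b := by
  have hsurj : Function.Surjective φ := fun n => ⟨n • b, by rw [map_smul, hφ, smul_eq_mul, mul_one]⟩
  have hrank : Module.finrank ℤ (LinearMap.ker φ) = m := by
    have h := (LinearMap.ker φ).finrank_quotient_add_finrank
    rw [(φ.quotKerEquivOfSurjective hsurj).finrank_eq, Module.finrank_self,
      Module.finrank_fin_fun] at h
    omega
  let e : LinearMap.ker φ ≃ₗ[ℤ] (Fin m → ℤ) := (Module.finBasisOfFinrankEq ℤ _ hrank).equivFun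
  let q : (Fin (m + 1) → ℤ) →ₗ[ℤ] LinearMap.ker φ :=
    (LinearMap.id - φ.smulRight b).codRestrict _ fun v => by
      simp [-zsmul_eq_mul, hφ]
  have hq (v) : (q v : Fin (m + 1) → ℤ) = v - φ v • b := rfl
  refine ⟨e.toLinearMap ∘ₗ q, (LinearMap.ker φ).subtype ∘ₗ e.symm.toLinearMap, ?_, fun w => ?_,
    fun v => ?_⟩
  · have : q b = 0 := Subtype.ext (by simp [hq, hφ])
    simp [this]
  · have : q (e.symm w) = e.symm w := Subtype.ext (by simp [hq])
    simp [this]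
  · simp [hq]

/-- If `M` splits as the direct sum of `N` and the multiples of `b`, then setting the monomial of
exponent `b` equal to `1` in the group algebra of `M` gives the group algebra of `N`. -/
noncomputable def AddMonoidAlgebra.quotientSpanSingleSubOneEquiv (k : Type*) [CommRing k]
    {M N : Type*} [AddCommGroup M] [AddCommGroup N] (b : M) (p : M →+ N) (s : N →+ M)
    (hb : p b = 0) (hps : ∀ w, p (s w) = w) (hv : ∀ v, ∃ n : ℤ, v = s (p v) + n • b) :
    (AddMonoidAlgebra k M ⧸ Ideal.span {(single b 1 : AddMonoidAlgebra k M) - 1}) ≃+*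
      AddMonoidAlgebra k N := by
  let I := Ideal.span {(single b 1 : AddMonoidAlgebra k M) - 1}
  let F : AddMonoidAlgebra k M ⧸ I →+* AddMonoidAlgebra k N :=
    Ideal.Quotient.lift I (mapDomainRingHom k p) fun a ha => by
      have : I ≤ RingHom.ker (mapDomainRingHom k p) := by
        rw [Ideal.span_singleton_le_iff_mem, RingHom.mem_ker]
        rw [map_sub, map_one, mapDomainRingHom_apply, mapDomain_single, hb, one_def, sub_self]
      exact this ha
  have hF (a) : F (Ideal.Quotient.mk I a) = mapDomainRingHom k p a := rfl
  let G : AddMonoidAlgebra k N →+* AddMonoidAlgebra k M ⧸ I :=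
    (Ideal.Quotient.mk I).comp (mapDomainRingHom k s)
  refine RingEquiv.ofRingHom F G ?_ ?_
  · refine ringHom_ext (fun r => ?_) fun w => ?_ <;> simp [G, hF, hps]
  · let g : Multiplicative M →* AddMonoidAlgebra k M ⧸ I :=
      (Ideal.Quotient.mk I : AddMonoidAlgebra k M →* _).comp (of k M)
    have hgb : g.toHomUnits (.ofAdd b) = 1 := Units.ext <|
      (Ideal.Quotient.eq (I := I)).2 (Ideal.subset_span rfl)
    have hg (v : M) : g (.ofAdd (s (p v))) = g (.ofAdd v) := by
      obtain ⟨n, hn⟩ := hv v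
      have h : g.toHomUnits (.ofAdd v) = g.toHomUnits (.ofAdd (s (p v))) := by
        conv_lhs => rw [hn, ofAdd_add, ofAdd_zsmul, map_mul, map_zpow, hgb, one_zpow, mul_one]
      exact (congrArg Units.val h).symm
    refine Ideal.Quotient.ringHom_ext (ringHom_ext (fun r => ?_) fun v => ?_)
    · change G (F (Ideal.Quotient.mk I _)) = Ideal.Quotient.mk I _
      simp [hF, G]
    · change G (F (Ideal.Quotient.mk I _)) = Ideal.Quotient.mk I _
      simpa [hF, G, g] using hg v

theorem stmt_12 (k : Type) [Field k] [CharZero k] (m : ℕ)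
    (b : Fin (m + 1) → ℤ)
    (hgcd : Finset.gcd Finset.univ (fun i => (b i).natAbs) = 1) :
    Nonempty
      ((AddMonoidAlgebra k (Fin (m + 1) → ℤ) ⧸
          Ideal.span {(AddMonoidAlgebra.single b 1 :
            AddMonoidAlgebra k (Fin (m + 1) → ℤ)) - 1}) ≃+*
        AddMonoidAlgebra k (Fin m → ℤ)) := by
  obtain ⟨c, hc⟩ := exists_sum_mul_eq_one_of_gcd_natAbs_eq_one b hgcd
  obtain ⟨p, s, hb, hps, hv⟩ := exists_projection_along (Fintype.linearCombination ℤ c) b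
    (by simpa [Fintype.linearCombination_apply, mul_comm] using hc)
  exact ⟨AddMonoidAlgebra.quotientSpanSingleSubOneEquiv k b p.toAddMonoidHom s.toAddMonoidHom
    hb hps fun v => ⟨_, hv v⟩⟩
end

section
/- Let k be a field of characteristic zero in which every element is a square (a quadratically closed field). Let n ≥ 3, let w : Fin (n+1) → ℕ with w i > 0 for all i, assume the well-formedness conditions: for every index i, Finset.gcd (Finset.univ.erase i) w = 1, and for every pair of distinct indices i ≠ j, the gcd of the remaining n − 1 weights divides d. Let i₀ ≠ j₀ be indices and set d = w i₀ + w j₀. Let F : MvPolynomial (Fin (n+1)) k be weighted homogeneous of degree d with respect to w (i.e. F ∈ MvPolynomial.weightedHomogeneousSubmodule k w d), and assume F is quasi-smooth in the Jacobian sense: for every field extension K of k and every nonzero point z : Fin (n+1) → K with (MvPolynomial.aeval z) F = 0, there exists an index i with (MvPolynomial.aeval z) (MvPolynomial.pderiv i F) ≠ 0. Then there exist a k-algebra automorphism φ of MvPolynomial (Fin (n+1)) k which preserves the weighted grading (φ maps MvPolynomial.weightedHomogeneousSubmodule k w m onto itself for every m), and indices p ≠ q with w p + w q = d, such that φ F =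 X p * X q + G for some polynomial G belonging to MvPolynomial.supported k ({p, q}ᶜ) (i.e. G involves only the variables other than X p and X q) and G is weighted homogeneous of degree d. -/
open MvPolynomial

namespace MvPolynomial

section Graded

variable {σ k : Type*} [Field k] {w : σ → ℕ}

/-- Exponent vectors comparable for the divisibility order and of the same weight coincide. -/
theorem eq_of_le_of_weight_eq (hw : ∀ i, 0 < w i) {s m : σ →₀ ℕ} (h : s ≤ m)
    (hsm : Finsupp.weight w m = Finsupp.weight w s) : m = s := by
  obtain ⟨r, rfl⟩ := exists_add_of_le h
  rw [map_add] at hsm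
  have hr : Finsupp.weight w r = 0 := by omega
  have : r = 0 := by
    ext i
    by_contra hi
    have h1 := Finsupp.le_weight_of_ne_zero' w (s := i) (f := r) (by simpa using hi)
    have := hw i
    omega
  simp [this]

theorem mem_supported_compl {s : Set σ} {F : MvPolynomial σ k}
    (h : ∀ m, coeff m F ≠ 0 → ∀ i ∈ s, m i = 0) : F ∈ supported k sᶜ := by
  rw [mem_supported]
  intro i hi his
  obtain ⟨m, hm, hmi⟩ := (mem_vars_iff_mem_support i).1 hi
  exact (Finsupp.mem_support_iff.1 hmi) (h m (mem_support_iff.1 hm) i his)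

theorem apply_eq_zero_of_mem_supported_compl {s : Set σ} {F : MvPolynomial σ k}
    (h : F ∈ supported k sᶜ) {m : σ →₀ ℕ} (hm : coeff m F ≠ 0) {i : σ} (hi : i ∈ s) :
    m i = 0 := by
  by_contra hmi
  exact mem_supported.1 h ((mem_vars_iff_mem_support i).2
    ⟨m, mem_support_iff.2 hm, Finsupp.mem_support_iff.2 hmi⟩) hi

theorem map_mem_of_mem_supported {s : Set σ} {F : MvPolynomial σ k} (hF : F ∈ supported k s)
    (φ : MvPolynomial σ k →ₐ[k] MvPolynomial σ k) (S : Subalgebra k (MvPolynomial σ k))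
    (h : ∀ i ∈ s, φ (X i) ∈ S) : φ F ∈ S := by
  have : supported k s ≤ S.comap φ := by
    rw [supported_eq_adjoin_X, Algebra.adjoin_le_iff]
    rintro _ ⟨i, hi, rfl⟩
    exact h i hi
  exact this hF

theorem map_eq_self_of_mem_supported {s : Set σ} {F : MvPolynomial σ k} (hF : F ∈ supported k s)
    (φ : MvPolynomial σ k →ₐ[k] MvPolynomial σ k) (h : ∀ i ∈ s, φ (X i) = X i) : φ F = F := by
  have : supported k s ≤ AlgHom.equalizer φ (AlgHom.id k _) := by
    rw [supported_eq_adjoin_X, Algebra.adjoin_le_iff]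
    rintro _ ⟨i, hi, rfl⟩
    exact h i hi
  exact this hF

theorem IsWeightedHomogeneous.aeval_of_X {F : MvPolynomial σ k} {d : ℕ}
    (hF : IsWeightedHomogeneous w F d) {f : σ → MvPolynomial σ k}
    (hf : ∀ i, IsWeightedHomogeneous w (f i) (w i)) :
    IsWeightedHomogeneous w (aeval f F) d := by
  rw [aeval_eq_bind₁, bind₁, aeval_def, eval₂_eq]
  refine IsWeightedHomogeneous.sum _ _ _ fun m hm => ?_
  have hm' := hF (mem_support_iff.1 hm)
  rw [← hm', Finsupp.weight_apply, Finsupp.sum, algebraMap_eq]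
  refine IsWeightedHomogeneous.C_mul (IsWeightedHomogeneous.prod _ _ _ fun i _ => ?_) _
  exact (hf i).pow _

theorem IsWeightedHomogeneous.divMonomial_single {F : MvPolynomial σ k} {d e : ℕ} {p : σ}
    (hF : IsWeightedHomogeneous w F d) (hd : w p + e = d) :
    IsWeightedHomogeneous w (MvPolynomial.divMonomial F (Finsupp.single p 1)) e := by
  intro m hm
  rw [coeff_divMonomial] at hm
  have := hF hm
  rw [map_add, Finsupp.weight_single, one_smul] at this
  omega

theorem IsWeightedHomogeneous.modMonomial {F : MvPolynomial σ k} {d : ℕ} {s : σ →₀ ℕ}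
    (hF : IsWeightedHomogeneous w F d) :
    IsWeightedHomogeneous w (MvPolynomial.modMonomial F s) d := by
  intro m hm
  by_cases hs : s ≤ m
  · exact absurd (coeff_modMonomial_of_le _ hs) hm
  · rw [coeff_modMonomial_of_not_le _ hs] at hm
    exact hF hm

theorem modMonomial_single_mem_supported (F : MvPolynomial σ k) (p : σ) :
    modMonomial F (Finsupp.single p 1) ∈ supported k ({p}ᶜ : Set σ) := by
  refine mem_supported_compl fun m hm i hi => ?_
  rw [Set.mem_singleton_iff.1 hi]
  by_contra hmi
  exact hm (coeff_modMonomial_of_le _ (Finsupp.single_le_iff.2 (Nat.one_le_iff_ne_zero.2 hmi)))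

/-- A polynomial of the same degree as the variable `X q` is affine in that variable. -/
theorem IsWeightedHomogeneous.exists_eq_C_mul_X_add (hw : ∀ i, 0 < w i)
    {F : MvPolynomial σ k} {q : σ} (hF : IsWeightedHomogeneous w F (w q)) :
    ∃ H ∈ supported k ({q}ᶜ : Set σ), IsWeightedHomogeneous w H (w q) ∧
      F = C (coeff (Finsupp.single q 1) F) * X q + H := by
  refine ⟨_, modMonomial_single_mem_supported F q, hF.modMonomial, ?_⟩
  conv_lhs => rw [← divMonomial_add_modMonomial_single F q]
  congr 1
  rw [mul_comm]
  congr 1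
  classical
  ext m
  rw [coeff_divMonomial, coeff_C]
  split_ifs with h
  · rw [← h, add_zero]
  · by_contra hm
    have h1 := eq_of_le_of_weight_eq hw (le_self_add (a := Finsupp.single q 1) (b := m))
      (by rw [hF hm, Finsupp.weight_single, one_smul])
    exact h (left_eq_add.1 h1.symm).symm

/-- An automorphism of the polynomial ring preserving the weighted grading. -/
def IsGradedAut (w : σ → ℕ) (φ : MvPolynomial σ k ≃ₐ[k] MvPolynomial σ k) : Prop :=
  ∀ F m, IsWeightedHomogeneous w (φ F) m ↔ IsWeightedHomogeneous w F m

theorem IsGradedAut.trans {φ ψ : MvPolynomial σ k ≃ₐ[k] MvPolynomial σ k}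
    (hφ : IsGradedAut w φ) (hψ : IsGradedAut w ψ) : IsGradedAut w (φ.trans ψ) :=
  fun F m => (hψ (φ F) m).trans (hφ F m)

theorem IsGradedAut.map_eq {φ : MvPolynomial σ k ≃ₐ[k] MvPolynomial σ k}
    (hφ : IsGradedAut w φ) (m : ℕ) :
    Submodule.map φ.toLinearMap (weightedHomogeneousSubmodule k w m) =
      weightedHomogeneousSubmodule k w m := by
  ext F
  rw [Submodule.mem_map, mem_weightedHomogeneousSubmodule]
  constructor
  · rintro ⟨G, hG, rfl⟩
    exact (hφ G m).2 hG
  · intro hF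
    refine ⟨φ.symm F, ?_, by simp⟩
    rw [mem_weightedHomogeneousSubmodule, ← hφ, AlgEquiv.apply_symm_apply]
    exact hF

/-- The elementary graded automorphism `X q ↦ c * X q + h`, with `h` not involving `X q`. -/
theorem exists_isGradedAut (q : σ) {c : k} (hc : c ≠ 0) {h : MvPolynomial σ k}
    (hq : h ∈ supported k ({q}ᶜ : Set σ)) (hh : IsWeightedHomogeneous w h (w q)) :
    ∃ φ : MvPolynomial σ k ≃ₐ[k] MvPolynomial σ k, IsGradedAut w φ ∧
      φ (X q) = C c * X q + h ∧ ∀ i, i ≠ q → φ (X i) = X i := by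
  classical
  set f : σ → MvPolynomial σ k := Function.update X q (C c * X q + h) with hf
  set g : σ → MvPolynomial σ k := Function.update X q (C c⁻¹ * (X q - h)) with hg
  have hX := isWeightedHomogeneous_X (R := k) w
  have fixed : ∀ u : σ → MvPolynomial σ k, (∀ i, i ≠ q → u i = X i) → aeval u h = h :=
    fun u hu => map_eq_self_of_mem_supported hq _ fun i hi => by
      rw [aeval_X]
      exact hu i hi
  have hfne : ∀ i, i ≠ q → f i = X i := fun i hi => by simp [hf, hi]
  have hgne : ∀ i, i ≠ q → g i = X i := fun i hi => by simp [hg, hi]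
  have hfq : f q = C c * X q + h := by simp [hf]
  have hgq : g q = C c⁻¹ * (X q - h) := by simp [hg]
  have hcc : (C c * C c⁻¹ : MvPolynomial σ k) = 1 := by rw [← C_mul, mul_inv_cancel₀ hc, C_1]
  have hfh : ∀ i, IsWeightedHomogeneous w (f i) (w i) := fun i => by
    by_cases hi : i = q
    · rw [hi, hfq]
      exact ((hX q).C_mul c).add hh
    · rw [hfne i hi]
      exact hX i
  have hgh : ∀ i, IsWeightedHomogeneous w (g i) (w i) := fun i => by
    by_cases hi : i = q
    · rw [hi, hgq]
      exact ((hX q).sub hh).C_mul _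
    · rw [hgne i hi]
      exact hX i
  have hfg : (aeval f).comp (aeval g) = AlgHom.id k (MvPolynomial σ k) := by
    refine algHom_ext fun i => ?_
    by_cases hi : i = q
    · simp only [hi, AlgHom.comp_apply, aeval_X, hgq, map_mul, map_sub, fixed f hfne, hfq,
        algHom_C, algebraMap_eq, AlgHom.id_apply]
      linear_combination (X q) * hcc
    · simp [hgne i hi, hfne i hi]
  have hgf : (aeval g).comp (aeval f) = AlgHom.id k (MvPolynomial σ k) := by
    refine algHom_ext fun i => ?_
    by_cases hi : i = q
    · simp only [hi, AlgHom.comp_apply, aeval_X, hgq, map_mul, map_add, fixed g hgne, hfq,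
        algHom_C, algebraMap_eq, AlgHom.id_apply]
      linear_combination (X q - h) * hcc
    · simp [hgne i hi, hfne i hi]
  refine ⟨AlgEquiv.ofAlgHom (aeval f) (aeval g) hfg hgf, fun F m => ⟨fun hF => ?_, fun hF => ?_⟩,
    by simp [hfq], fun i hi => by simp [hfne i hi]⟩
  · have h1 := hF.aeval_of_X hgh
    rwa [AlgEquiv.ofAlgHom_apply, ← AlgHom.comp_apply, hgf] at h1
  · exact hF.aeval_of_X hfh

/-- A weighted homogeneous polynomial in which the variable `X l` occurs as a monomial can be taken
to `X l + H` for any `H` of the same degree not involving `X l`. -/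
theorem exists_isGradedAut_eq_X_add (hw : ∀ i, 0 < w i) {F : MvPolynomial σ k} {l : σ}
    (hF : IsWeightedHomogeneous w F (w l)) (hl : coeff (Finsupp.single l 1) F ≠ 0)
    {H : MvPolynomial σ k} (hH : H ∈ supported k ({l}ᶜ : Set σ))
    (hHw : IsWeightedHomogeneous w H (w l)) :
    ∃ φ : MvPolynomial σ k ≃ₐ[k] MvPolynomial σ k, IsGradedAut w φ ∧ φ F = X l + H ∧
      (∀ i, i ≠ l → φ (X i) = X i) ∧ φ (X l) ∈ Algebra.adjoin k {X l, F, H} := by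
  obtain ⟨F', hF', hFw', hFF'⟩ := hF.exists_eq_C_mul_X_add hw
  set c := coeff (Finsupp.single l 1) F
  obtain ⟨φ, hφ, hφl, hφi⟩ := exists_isGradedAut (w := w) l (inv_ne_zero hl)
    (h := C c⁻¹ * (H - F')) (Subalgebra.mul_mem _ (Subalgebra.algebraMap_mem _ _)
      (Subalgebra.sub_mem _ hH hF')) ((hHw.sub hFw').C_mul _)
  have mem : ∀ G ∈ ({X l, F, H} : Set (MvPolynomial σ k)), G ∈ Algebra.adjoin k {X l, F, H} :=
    fun G hG => Algebra.subset_adjoin hG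
  refine ⟨φ, hφ, ?_, hφi, ?_⟩
  swap
  · rw [hφl, show F' = F - C c * X l by rw [← sub_eq_iff_eq_add'.2 hFF']]
    have hC : ∀ a : k, (C a : MvPolynomial σ k) ∈ Algebra.adjoin k {X l, F, H} :=
      Subalgebra.algebraMap_mem _
    exact add_mem (mul_mem (hC _) (mem _ (by simp))) (mul_mem (hC _) (sub_mem (mem _ (by simp))
      (sub_mem (mem _ (by simp)) (mul_mem (hC _) (mem _ (by simp))))))
  have hcc : (C c * C c⁻¹ : MvPolynomial σ k) = 1 := by rw [← C_mul, mul_inv_cancel₀ hl, C_1]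
  have h1 : φ F' = F' := map_eq_self_of_mem_supported hF' φ.toAlgHom fun i hi => hφi i hi
  have h2 : φ (C c) = C c := φ.commutes c
  rw [hFF', map_add, map_mul, h1, h2, hφl]
  linear_combination (X l + H - F') * hcc

/-- If the product `X p * X q` occurs in `F` and `X p` occurs at most linearly, then `F` can be
brought to the form `X p * X q + G` with `G` free of `X p` and `X q`. -/
theorem exists_isGradedAut_eq_X_mul_X_add (hw : ∀ i, 0 < w i) {F : MvPolynomial σ k} {p q : σ}
    (hpq : p ≠ q) (hle : w q ≤ w p) (hF : IsWeightedHomogeneous w F (w p + w q))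
    (hpp : coeff (Finsupp.single p 2) F = 0)
    (hc : coeff (Finsupp.single p 1 + Finsupp.single q 1) F ≠ 0) :
    ∃ φ : MvPolynomial σ k ≃ₐ[k] MvPolynomial σ k, IsGradedAut w φ ∧
      ∃ G ∈ supported k ({p, q}ᶜ : Set σ),
        φ F = X p * X q + G ∧ IsWeightedHomogeneous w G (w p + w q) := by
  set A := divMonomial F (Finsupp.single p 1) with hA
  set B := modMonomial F (Finsupp.single p 1) with hB
  have hFAB : X p * A + B = F := divMonomial_add_modMonomial_single F p
  have hAw : IsWeightedHomogeneous w A (w q) := hF.divMonomial_single rfl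
  have hBs : B ∈ supported k ({p}ᶜ : Set σ) := modMonomial_single_mem_supported F p
  have hAs : A ∈ supported k ({p}ᶜ : Set σ) := by
    refine mem_supported_compl fun m hm i hi => ?_
    rw [Set.mem_singleton_iff.1 hi]
    by_contra hmi
    rw [hA, coeff_divMonomial] at hm
    have hle2 : Finsupp.single p 2 ≤ Finsupp.single p 1 + m := by
      rw [Finsupp.single_le_iff, Finsupp.add_apply, Finsupp.single_eq_same]
      omega
    have hm' := hF hm
    have h2 : Finsupp.weight w (Finsupp.single p 2) = 2 * w p := by
      rw [Finsupp.weight_single, smul_eq_mul]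
    have h3 : Finsupp.weight w (Finsupp.single p 2) ≤
        Finsupp.weight w (Finsupp.single p 1 + m) := by
      obtain ⟨r, hr⟩ := exists_add_of_le hle2
      rw [hr, map_add]
      omega
    rw [eq_of_le_of_weight_eq hw hle2 (by omega)] at hm
    exact hm hpp
  have hqp : X q ∈ supported k ({p}ᶜ : Set σ) := X_mem_supported.2 (by simpa using hpq.symm)
  have hAq : coeff (Finsupp.single q 1) A ≠ 0 := by rwa [hA, coeff_divMonomial]
  obtain ⟨φ, hφ, hφA, hφi, hφq⟩ := exists_isGradedAut_eq_X_add hw hAw hAq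
    (Subalgebra.zero_mem _) (isWeightedHomogeneous_zero k w _)
  have hφB : φ B ∈ supported k ({p}ᶜ : Set σ) := by
    refine map_mem_of_mem_supported hBs φ.toAlgHom _ fun i hi => ?_
    by_cases hiq : i = q
    · rw [hiq]
      refine Algebra.adjoin_le ?_ hφq
      rintro G (rfl | rfl | rfl)
      exacts [hqp, hAs, Subalgebra.zero_mem _]
    · exact (hφi i hiq).symm ▸ X_mem_supported.2 hi
  have hφF : φ F = X p * X q + φ B := by
    conv_lhs => rw [← hFAB]
    rw [map_add, map_mul, hφi p hpq, hφA, add_zero]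
  have hφBw : IsWeightedHomogeneous w (φ B) (w p + w q) := (hφ _ _).2 hF.modMonomial
  set D := divMonomial (φ B) (Finsupp.single q 1) with hD
  set G := modMonomial (φ B) (Finsupp.single q 1) with hG
  have hDG : X q * D + G = φ B := divMonomial_add_modMonomial_single (φ B) q
  have hDw : IsWeightedHomogeneous w D (w p) := hφBw.divMonomial_single (add_comm _ _)
  have hDs : D ∈ supported k ({p}ᶜ : Set σ) := by
    refine mem_supported_compl fun m hm i hi => ?_
    rw [hD, coeff_divMonomial] at hm
    have := apply_eq_zero_of_mem_supported_compl hφB hm hi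
    rw [Finsupp.add_apply] at this
    omega
  have hGq : G ∈ supported k ({q}ᶜ : Set σ) := modMonomial_single_mem_supported _ q
  have hGp : G ∈ supported k ({p}ᶜ : Set σ) := by
    rw [← sub_eq_of_eq_add' hDG.symm]
    exact sub_mem hφB (mul_mem hqp hDs)
  have hGw : IsWeightedHomogeneous w G (w p + w q) := hφBw.modMonomial
  obtain ⟨ψ, hψ, hψp, hψi⟩ := exists_isGradedAut (w := w) p one_ne_zero (neg_mem hDs) hDw.neg
  have fixed : ∀ {H}, H ∈ supported k ({p}ᶜ : Set σ) → ψ H = H :=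
    fun hH => map_eq_self_of_mem_supported hH ψ.toAlgHom hψi
  refine ⟨φ.trans ψ, hφ.trans hψ, G, mem_supported_compl fun m hm i hi => ?_, ?_, hGw⟩
  · rcases hi with rfl | rfl
    · exact apply_eq_zero_of_mem_supported_compl hGp hm rfl
    · exact apply_eq_zero_of_mem_supported_compl hGq hm rfl
  · rw [AlgEquiv.trans_apply, hφF, ← hDG, map_add, map_mul, map_add, map_mul, hψp, fixed hDs,
      fixed hqp, fixed hGp, C_1]
    ring

end Graded

section Nonsingular

variable {σ k : Type*} [Field k] {w : σ → ℕ}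

/-- The affine cone `F = 0` has no singular rational point other than the origin. -/
def IsQuasiSmooth (F : MvPolynomial σ k) : Prop :=
  ∀ z : σ → k, z ≠ 0 → eval z F = 0 → ∃ i, eval z (pderiv i F) ≠ 0

theorem pderiv_algHom [Fintype σ] (ψ : MvPolynomial σ k →ₐ[k] MvPolynomial σ k) (j : σ)
    (G : MvPolynomial σ k) :
    pderiv j (ψ G) = ∑ i, ψ (pderiv i G) * pderiv j (ψ (X i)) := by
  classical
  induction G using MvPolynomial.induction_on with
  | C a => simp [algHom_C]
  | add p q hp hq => simp [hp, hq, add_mul, Finset.sum_add_distrib]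
  | mul_X p l hp =>
    simp only [map_mul, pderiv_mul, hp, map_add, add_mul, Finset.sum_add_distrib, pderiv_X,
      Finset.sum_mul]
    congr 1
    · exact Finset.sum_congr rfl fun i _ => by ring
    · rw [Finset.sum_eq_single l]
      · simp
      · intro i _ hi
        simp [Pi.single_eq_of_ne hi.symm]
      · simp

theorem IsQuasiSmooth.map [Fintype σ] (hw : ∀ i, 0 < w i) {F : MvPolynomial σ k}
    (hF : IsQuasiSmooth F) {φ : MvPolynomial σ k ≃ₐ[k] MvPolynomial σ k}
    (hφ : IsGradedAut w φ) : IsQuasiSmooth (φ F) := by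
  intro z hz hzF
  set z' : σ → k := fun i => eval z (φ (X i)) with hz'
  have key : ∀ G, eval z (φ G) = eval z' G := fun G => by
    have : (aeval z).comp φ.toAlgHom = aeval z' := algHom_ext fun i => by
      simp [hz', aeval_eq_eval]
    simpa [aeval_eq_eval] using DFunLike.congr_fun this G
  have key' : ∀ G, eval z' (φ.symm G) = eval z G := fun G => by
    rw [← key, AlgEquiv.apply_symm_apply]
  have hz'0 : z' ≠ 0 := by
    intro h0
    refine hz (_root_.funext fun i => ?_)
    have h1 : IsWeightedHomogeneous w (φ.symm (X i)) (w i) := by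
      rw [← hφ, AlgEquiv.apply_symm_apply]
      exact isWeightedHomogeneous_X k w i
    have h2 := key' (X i)
    rw [h0, eval_X] at h2
    rw [← h2, Pi.zero_apply]
    have h3 : coeff 0 (φ.symm (X i)) = 0 := h1.coeff_eq_zero 0 (by simpa using (hw i).ne)
    simpa [eval_zero, constantCoeff_eq] using h3
  by_contra! hsing
  obtain ⟨j, hj⟩ := hF z' hz'0 (by rw [← key, hzF])
  refine hj ?_
  have hsum : pderiv j F = ∑ i, φ.symm (pderiv i (φ F)) * pderiv j (φ.symm (X i)) := by
    simpa using pderiv_algHom φ.symm.toAlgHom j (φ F)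
  rw [hsum, map_sum]
  refine Finset.sum_eq_zero fun i _ => ?_
  rw [map_mul, key', hsing, zero_mul]

theorem eval_single_ne_zero [DecidableEq σ] {F : MvPolynomial σ k} {p : σ}
    (h : eval (Pi.single p 1) F ≠ 0) : ∃ m, coeff (Finsupp.single p m) F ≠ 0 := by
  rw [eval_eq] at h
  obtain ⟨m, hm, hne⟩ := Finset.exists_ne_zero_of_sum_ne_zero h
  refine ⟨m p, ?_⟩
  have : m = Finsupp.single p (m p) := by
    ext i
    by_cases hi : i = p
    · simp [hi]
    · rw [Finsupp.single_eq_of_ne hi]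
      by_contra hmi
      refine hne (mul_eq_zero_of_right _ (Finset.prod_eq_zero (Finsupp.mem_support_iff.2 hmi) ?_))
      rw [Pi.single_eq_of_ne hi, zero_pow hmi]
  rw [← this]
  exact mem_support_iff.1 hm

/-- Quasi-smoothness at a vertex of weight `d / 2 ≤ w p < d` lying on the hypersurface forces a
monomial `X q` or `X p * X q`. -/
theorem IsQuasiSmooth.exists_coeff_ne_zero {F : MvPolynomial σ k} {p : σ} {d : ℕ}
    (hq : IsQuasiSmooth F) (hF : IsWeightedHomogeneous w F d) (hw : ∀ i, 0 < w i)
    (hpd : w p < d) (hdp : d ≤ 2 * w p) (hpp : coeff (Finsupp.single p 2) F = 0) :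
    (∃ q, coeff (Finsupp.single q 1) F ≠ 0) ∨
      ∃ q, p ≠ q ∧ coeff (Finsupp.single p 1 + Finsupp.single q 1) F ≠ 0 := by
  classical
  have h0 : eval (Pi.single p 1) F = 0 := by
    by_contra hne
    obtain ⟨m, hm⟩ := eval_single_ne_zero hne
    have hmd := hF hm
    rw [Finsupp.weight_single, smul_eq_mul] at hmd
    obtain rfl | rfl | rfl | hm3 : m = 0 ∨ m = 1 ∨ m = 2 ∨ 3 ≤ m := by omega
    · omega
    · omega
    · exact hm hpp
    · have := hw p
      nlinarith
  obtain ⟨q, hq⟩ := hq _ (by simp [Pi.single_eq_zero_iff]) h0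
  obtain ⟨m, hm⟩ := eval_single_ne_zero hq
  rw [coeff_pderiv] at hm
  have hm' := left_ne_zero_of_mul hm
  have hmd := hF hm'
  rw [map_add, Finsupp.weight_single, Finsupp.weight_single, smul_eq_mul, one_smul] at hmd
  have hwq := hw q
  obtain rfl | rfl | hm2 : m = 0 ∨ m = 1 ∨ 2 ≤ m := by omega
  · exact Or.inl ⟨q, by simpa using hm'⟩
  · refine Or.inr ⟨q, ?_, hm'⟩
    rintro rfl
    rw [← Finsupp.single_add] at hm'
    exact hm' hpp
  · nlinarith

theorem eval_single_add_single [DecidableEq σ] {F : MvPolynomial σ k} {i j : σ} {d : ℕ}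
    (hw : ∀ i, 0 < w i) (hij : i ≠ j) (hi : w i + w i = d) (hj : w j + w j = d)
    (hF : IsWeightedHomogeneous w F d) (s t : k) :
    eval (Pi.single i s + Pi.single j t) F = coeff (Finsupp.single i 2) F * s ^ 2 +
      coeff (Finsupp.single i 1 + Finsupp.single j 1) F * (s * t) +
      coeff (Finsupp.single j 2) F * t ^ 2 := by
  set z : σ → k := Pi.single i s + Pi.single j t with hz
  have hzi : z i = s := by simp [hz, hij]
  have hzj : z j = t := by simp [hz, hij.symm]
  have hzl : ∀ l, l ≠ i → l ≠ j → z l = 0 := fun l h1 h2 => by simp [hz, h1, h2]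
  have classify : ∀ m : σ →₀ ℕ, coeff m F ≠ 0 → (∀ l, m l ≠ 0 → l = i ∨ l = j) →
      m = Finsupp.single i 2 ∨ m = Finsupp.single i 1 + Finsupp.single j 1 ∨
        m = Finsupp.single j 2 := by
    intro m hm hl
    have hmij : m = Finsupp.single i (m i) + Finsupp.single j (m j) := by
      ext l
      by_cases h1 : l = i
      · simp [h1, hij]
      by_cases h2 : l = j
      · simp [h2, hij.symm]
      · rw [Finsupp.add_apply, Finsupp.single_eq_of_ne h1, Finsupp.single_eq_of_ne h2]
        by_contra hml
        exact (hl l hml).elim h1 h2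
    have hmd := hF hm
    rw [hmij, map_add, Finsupp.weight_single, Finsupp.weight_single, smul_eq_mul, smul_eq_mul,
      show w j = w i by omega, ← add_mul, ← hi, ← two_mul] at hmd
    have h2 := Nat.eq_of_mul_eq_mul_right (hw i) hmd
    obtain h | h | h : m i = 0 ∨ m i = 1 ∨ m i = 2 := by omega
    · rw [hmij, h, show m j = 2 by omega]
      simp
    · rw [hmij, h, show m j = 1 by omega]
      simp
    · rw [hmij, h, show m j = 0 by omega]
      simp
  set f : (σ →₀ ℕ) → k := fun m => eval z (monomial m (coeff m F)) with hf
  set S : Finset (σ →₀ ℕ) := {Finsupp.single i 2, Finsupp.single i 1 + Finsupp.single j 1,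
    Finsupp.single j 2} with hS
  have h1 : eval z F = ∑ m ∈ F.support, f m := by
    conv_lhs => rw [F.as_sum, map_sum]
  have h2 : ∑ m ∈ F.support, f m = ∑ m ∈ F.support ∪ S, f m := by
    refine Finset.sum_subset Finset.subset_union_left fun m _ hm => ?_
    simp [hf, notMem_support_iff.1 hm]
  have h3 : ∑ m ∈ S, f m = ∑ m ∈ F.support ∪ S, f m := by
    refine Finset.sum_subset Finset.subset_union_right fun m _ hm => ?_
    by_contra hne
    have hne' : coeff m F * m.prod (fun l e => z l ^ e) ≠ 0 := by rwa [← eval_monomial]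
    refine hm ?_
    simp only [hS, Finset.mem_insert, Finset.mem_singleton]
    refine classify m (left_ne_zero_of_mul hne') fun l hml => ?_
    by_contra! hl
    exact right_ne_zero_of_mul hne' (Finset.prod_eq_zero (Finsupp.mem_support_iff.2 hml)
      (by simp [hzl l hl.1 hl.2, hml]))
  have h12 : Finsupp.single i 2 ≠ Finsupp.single i 1 + Finsupp.single j 1 := fun h => by
    simpa [hij] using DFunLike.congr_fun h i
  have h13 : Finsupp.single i 2 ≠ Finsupp.single j 2 := fun h => by
    simpa [hij] using DFunLike.congr_fun h i
  have h23 : Finsupp.single i 1 + Finsupp.single j 1 ≠ Finsupp.single j 2 := fun h => by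
    simpa [hij] using DFunLike.congr_fun h i
  rw [h1, h2, ← h3, hS, Finset.sum_insert (by simp [h12, h13]), Finset.sum_pair h23]
  have hprod : (Finsupp.single i 1 + Finsupp.single j 1).prod (fun l e => z l ^ e) = s * t := by
    rw [Finsupp.prod_add_index' (by simp) (by simp [pow_add])]
    simp [hzi, hzj]
  simp only [hf, eval_monomial, hprod]
  rw [Finsupp.prod_single_index (by simp), Finsupp.prod_single_index (by simp), hzi, hzj]
  ring

theorem eval_single_eq_coeff_single_two [DecidableEq σ] {F : MvPolynomial σ k} {i j : σ} {d : ℕ}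
    (hw : ∀ i, 0 < w i) (hij : i ≠ j) (hi : w i + w i = d) (hj : w j + w j = d)
    (hF : IsWeightedHomogeneous w F d) :
    eval (Pi.single j 1) F = coeff (Finsupp.single j 2) F := by
  simpa using eval_single_add_single hw hij hi hj hF 0 1

/-- Over a quadratically closed field of characteristic not two, two variables of weight `d / 2`
can be changed by a graded automorphism so that the square of one of them does not occur. -/
theorem exists_isGradedAut_coeff_single_two_eq_zero (hsq : ∀ x : k, ∃ y : k, y ^ 2 = x)
    (h2 : (2 : k) ≠ 0) (hw : ∀ i, 0 < w i) {F : MvPolynomial σ k} {i j : σ} {d : ℕ}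
    (hij : i ≠ j) (hi : w i + w i = d) (hj : w j + w j = d) (hF : IsWeightedHomogeneous w F d) :
    ∃ φ : MvPolynomial σ k ≃ₐ[k] MvPolynomial σ k, IsGradedAut w φ ∧
      (coeff (Finsupp.single i 2) (φ F) = 0 ∨ coeff (Finsupp.single j 2) (φ F) = 0) := by
  classical
  by_cases hα : coeff (Finsupp.single i 2) F = 0
  · exact ⟨AlgEquiv.refl, fun _ _ => Iff.rfl, Or.inl hα⟩
  set α := coeff (Finsupp.single i 2) F
  set β := coeff (Finsupp.single i 1 + Finsupp.single j 1) F with hβ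
  set γ := coeff (Finsupp.single j 2) F with hγ
  obtain ⟨r, hr⟩ := hsq (β ^ 2 - 4 * α * γ)
  obtain ⟨s, hs⟩ : ∃ s : k, α * s ^ 2 + β * s + γ = 0 := by
    have : NeZero (2 : k) := ⟨h2⟩
    obtain ⟨s, hs⟩ := exists_quadratic_eq_zero hα (b := β) (c := γ)
      ⟨r, by rw [discrim, ← hr, sq]⟩
    exact ⟨s, by rw [← hs]; ring⟩
  have hXj : X j ∈ supported k ({i}ᶜ : Set σ) := X_mem_supported.2 (by simpa using hij.symm)
  have hXw : IsWeightedHomogeneous w (X j : MvPolynomial σ k) (w i) := by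
    rw [show w i = w j by omega]
    exact isWeightedHomogeneous_X k w j
  obtain ⟨φ, hφ, hφi, hφl⟩ := exists_isGradedAut (w := w) i one_ne_zero
    (mul_mem (Subalgebra.algebraMap_mem _ s) hXj) (hXw.C_mul s)
  refine ⟨φ, hφ, Or.inr ?_⟩
  rw [← eval_single_eq_coeff_single_two hw hij hi hj ((hφ _ _).2 hF)]
  have hcomp : (aeval (Pi.single j (1 : k))).comp φ.toAlgHom =
      aeval (Pi.single i s + Pi.single j (1 : k)) := algHom_ext fun l => by
    by_cases hl : l = i
    · simp [hl, hφi, hij, algebraMap_eq]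
    · simp [hl, hφl]
  have := DFunLike.congr_fun hcomp F
  simp only [AlgHom.comp_apply, aeval_eq_eval] at this
  refine Eq.trans this ?_
  refine (eval_single_add_single hw hij hi hj hF s 1).trans ?_
  rw [← hs]
  ring

/-- The normal form for a vertex at which `F` has no square term. -/
theorem IsQuasiSmooth.exists_normalForm (hw : ∀ i, 0 < w i) {F : MvPolynomial σ k} {p q : σ}
    (hqs : IsQuasiSmooth F) (hpq : p ≠ q) (hle : w q ≤ w p)
    (hF : IsWeightedHomogeneous w F (w p + w q)) (hpp : coeff (Finsupp.single p 2) F = 0) :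
    ∃ φ : MvPolynomial σ k ≃ₐ[k] MvPolynomial σ k, IsGradedAut w φ ∧
      ∃ a b, a ≠ b ∧ w a + w b = w p + w q ∧ ∃ G ∈ supported k ({a, b}ᶜ : Set σ),
        φ F = X a * X b + G ∧ IsWeightedHomogeneous w G (w p + w q) := by
  have hwp := hw p
  have hwq := hw q
  obtain ⟨l, hl⟩ | ⟨b, hpb, hb⟩ :=
    hqs.exists_coeff_ne_zero hF hw (by omega) (by omega) hpp
  · have hwl : w l = w p + w q := by simpa [Finsupp.weight_single] using hF hl
    rw [← hwl] at hF ⊢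
    have hpl : p ≠ l := by
      rintro rfl
      omega
    have hql : q ≠ l := by
      rintro rfl
      omega
    obtain ⟨φ, hφ, hφF, -⟩ := exists_isGradedAut_eq_X_add hw hF hl (H := X p * X q)
      (mul_mem (X_mem_supported.2 (by simpa using hpl)) (X_mem_supported.2 (by simpa using hql)))
      (hwl ▸ (isWeightedHomogeneous_X k w p).mul (isWeightedHomogeneous_X k w q))
    exact ⟨φ, hφ, p, q, hpq, hwl.symm, X l, X_mem_supported.2 (by simp [hpl.symm, hql.symm]),
      by rw [hφF, add_comm], isWeightedHomogeneous_X k w l⟩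
  · have hwb : w b = w q := by
      have := hF hb
      rw [map_add, Finsupp.weight_single, Finsupp.weight_single, one_smul, one_smul] at this
      omega
    rw [← hwb] at hF ⊢
    obtain ⟨φ, hφ, h⟩ := exists_isGradedAut_eq_X_mul_X_add hw hpb (by omega) hF hpp hb
    exact ⟨φ, hφ, p, b, hpb, rfl, h⟩

end Nonsingular

end MvPolynomial

theorem stmt_16 (k : Type) [Field k] [CharZero k]
    (hsq : ∀ x : k, ∃ y : k, y ^ 2 = x)
    (n : ℕ) (hn : 3 ≤ n) (w : Fin (n + 1) → ℕ) (hw : ∀ i, 0 < w i)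
    (i₀ j₀ : Fin (n + 1)) (hij : i₀ ≠ j₀) (d : ℕ) (hd : d = w i₀ + w j₀)
    (hwf₁ : ∀ i, Finset.gcd (Finset.univ.erase i) w = 1)
    (hwf₂ : ∀ i j : Fin (n + 1), i ≠ j →
      Finset.gcd ((Finset.univ.erase i).erase j) w ∣ d)
    (F : MvPolynomial (Fin (n + 1)) k)
    (hF : F ∈ weightedHomogeneousSubmodule k w d)
    (hqs : ∀ (K : Type) [Field K] [Algebra k K] (z : Fin (n + 1) → K),
      z ≠ 0 → (aeval z) F = 0 → ∃ i, (aeval z) (pderiv i F) ≠ 0) :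
    ∃ φ : MvPolynomial (Fin (n + 1)) k ≃ₐ[k] MvPolynomial (Fin (n + 1)) k,
      (∀ m : ℕ, Submodule.map φ.toLinearMap (weightedHomogeneousSubmodule k w m) =
        weightedHomogeneousSubmodule k w m) ∧
      ∃ p q : Fin (n + 1), p ≠ q ∧ w p + w q = d ∧
        ∃ G ∈ MvPolynomial.supported k ({p, q}ᶜ : Set (Fin (n + 1))),
          φ F = X p * X q + G ∧ G ∈ weightedHomogeneousSubmodule k w d := by
  rw [mem_weightedHomogeneousSubmodule] at hF
  have hq : IsQuasiSmooth F := fun z hz h0 => by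
    simpa [aeval_eq_eval] using hqs k z hz (by simpa [aeval_eq_eval] using h0)
  suffices h : ∃ φ : MvPolynomial (Fin (n + 1)) k ≃ₐ[k] MvPolynomial (Fin (n + 1)) k,
      IsGradedAut w φ ∧ ∃ p q, p ≠ q ∧ w p + w q = d ∧
        ∃ G ∈ supported k ({p, q}ᶜ : Set (Fin (n + 1))),
          φ F = X p * X q + G ∧ IsWeightedHomogeneous w G d by
    obtain ⟨φ, hφ, h⟩ := h
    exact ⟨φ, hφ.map_eq, h⟩
  have coeff_zero : ∀ p, 2 * w p ≠ d → coeff (Finsupp.single p 2) F = 0 := fun p hp =>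
    hF.coeff_eq_zero _ (by rwa [Finsupp.weight_single, smul_eq_mul])
  subst hd
  obtain hlt | heq | hgt := lt_trichotomy (w i₀) (w j₀)
  · rw [add_comm (w i₀)] at hF ⊢
    exact hq.exists_normalForm hw hij.symm hlt.le hF (coeff_zero _ (by omega))
  · obtain ⟨ψ, hψ, h⟩ := exists_isGradedAut_coeff_single_two_eq_zero hsq two_ne_zero hw hij
      (by omega) (by omega) hF
    have hFψ := (hψ _ _).2 hF
    have hqψ := hq.map hw hψ
    obtain h | h := h
    · obtain ⟨φ, hφ, h⟩ := hqψ.exists_normalForm hw hij heq.ge hFψ h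
      exact ⟨ψ.trans φ, hψ.trans hφ, h⟩
    · rw [add_comm (w i₀)] at hFψ ⊢
      obtain ⟨φ, hφ, h⟩ := hqψ.exists_normalForm hw hij.symm heq.le hFψ h
      exact ⟨ψ.trans φ, hψ.trans hφ, h⟩
  · exact hq.exists_normalForm hw hij hgt.le hF (coeff_zero _ (by omega))
end
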